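/- There exists a universal constant C > 0 with the following property. Let k₁, k₂ ∈ ℤ and let u, v : ℝ × ℝ² → ℂ be smooth functions such that for every t the functions u(t,·) and v(t,·) are Schwartz on ℝ², the spatial Fourier transform of u(t,·) is supported in { ξ ∈ ℝ² : 2^{k₁−1} ≤ |ξ| ≤ 2^{k₁+1} } and that of v(t,·) is supported in { ξ ∈ ℝ² : 2^{k₂−1} ≤ |ξ| ≤ 2^{k₂+1} }. Set N := (i∂_t + ∂₁² − ∂₂²)u and N' := (i∂_t + ∂₁² − ∂₂²)v. Then sup_{y ∈ ℝ²} ‖ u^y · v ‖_{L²(ℝ×ℝ²)} ≤ C · 2^{−|k₁−k₂|/2} · ( ‖u‖_{L⁴(ℝ×ℝ²)} + ‖u‖_{L^∞_t L²_x} + I(u,N)^{1/2} ) · ( ‖v‖_{L⁴(ℝ×ℝ²)} + ‖v‖_{L^∞_t L²_x} + I(v,N')^{1/2} ), provided the right-hand side is finite. -/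

import Mathlib

open MeasureTheory ENNReal NNReal

noncomputable section

/-- Fourier transform in the two spatial variables on `ℝ²`. -/
def spatialFourier (f : ℝ × ℝ → ℂ) (ξ : ℝ × ℝ) : ℂ :=
  ∫ x : ℝ × ℝ, Complex.exp (-(2 * Real.pi * (x.1 * ξ.1 + x.2 * ξ.2)) * Complex.I) * f x

/-- Euclidean length of `ξ ∈ ℝ²`. -/
def elen (ξ : ℝ × ℝ) : ℝ := Real.sqrt (ξ.1 ^ 2 + ξ.2 ^ 2)

/-- The `L^∞_t L²_x` norm, valued in `ℝ≥0∞`. -/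
def LinfL2 (u : ℝ × ℝ × ℝ → ℂ) : ℝ≥0∞ :=
  ⨆ t : ℝ, (∫⁻ x : ℝ × ℝ, (‖u (t, x.1, x.2)‖₊ : ℝ≥0∞) ^ 2) ^ (1 / 2 : ℝ)

/-- The space-time `L⁴` norm on `ℝ_t × ℝ²_x`, valued in `ℝ≥0∞`. -/
def L4norm (u : ℝ × ℝ × ℝ → ℂ) : ℝ≥0∞ :=
  (∫⁻ p : ℝ × ℝ × ℝ, (‖u p‖₊ : ℝ≥0∞) ^ 4) ^ (1 / 4 : ℝ)

/-- The space-time `L²` norm on `ℝ_t × ℝ²_x`, valued in `ℝ≥0∞`. -/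
def L2norm (u : ℝ × ℝ × ℝ → ℂ) : ℝ≥0∞ :=
  (∫⁻ p : ℝ × ℝ × ℝ, (‖u p‖₊ : ℝ≥0∞) ^ 2) ^ (1 / 2 : ℝ)

/-- The interaction functional `I(u,N) = sup_y ∫∫ |u^y| |N|`, valued in `ℝ≥0∞`. -/
def interact (u N : ℝ × ℝ × ℝ → ℂ) : ℝ≥0∞ :=
  ⨆ y : ℝ × ℝ, ∫⁻ p : ℝ × ℝ × ℝ,
    (‖u (p.1, p.2.1 - y.1, p.2.2 - y.2)‖₊ : ℝ≥0∞) * (‖N p‖₊ : ℝ≥0∞)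

/-- The hyperbolic Schrödinger operator `i∂_t + ∂₁² − ∂₂²`. -/
def hypSchrod (u : ℝ × ℝ × ℝ → ℂ) (p : ℝ × ℝ × ℝ) : ℂ :=
  Complex.I * fderiv ℝ u p (1, 0, 0)
    + fderiv ℝ (fun q => fderiv ℝ u q (0, 1, 0)) p (0, 1, 0)
    - fderiv ℝ (fun q => fderiv ℝ u q (0, 0, 1)) p (0, 0, 1)

open scoped FourierTransform SchwartzMap LineDeriv ComplexConjugate

/-- The Euclidean plane, as the `L²` product of two lines. -/
abbrev EPlane := WithLp 2 (ℝ × ℝ)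

/-- Transport of a Schwartz function on `ℝ × ℝ` to the Euclidean plane. -/
def toEPlane (g : 𝓢(ℝ × ℝ, ℂ)) : 𝓢(EPlane, ℂ) :=
  SchwartzMap.compCLMOfContinuousLinearEquiv ℂ (WithLp.prodContinuousLinearEquiv 2 ℝ ℝ ℝ) g

/-- Transport of a Schwartz function on the Euclidean plane to `ℝ × ℝ`. -/
def ofEPlane (g : 𝓢(EPlane, ℂ)) : 𝓢(ℝ × ℝ, ℂ) :=
  SchwartzMap.compCLMOfContinuousLinearEquiv ℂ (WithLp.prodContinuousLinearEquiv 2 ℝ ℝ ℝ).symm g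

lemma toEPlane_apply (g : 𝓢(ℝ × ℝ, ℂ)) (x : EPlane) : toEPlane g x = g x.ofLp := rfl

lemma ofEPlane_apply (g : 𝓢(EPlane, ℂ)) (x : ℝ × ℝ) : ofEPlane g x = g (WithLp.toLp 2 x) := rfl

lemma integral_ofLp {G : Type*} [NormedAddCommGroup G] [NormedSpace ℝ G] (f : ℝ × ℝ → G) :
    ∫ x : EPlane, f x.ofLp = ∫ x, f x :=
  (WithLp.volume_preserving_ofLp ℝ ℝ).integral_comp
    (MeasurableEquiv.toLp 2 (ℝ × ℝ)).symm.measurableEmbedding f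

lemma norm_toLp_eq_elen (ξ : ℝ × ℝ) : ‖(WithLp.toLp 2 ξ : EPlane)‖ = elen ξ := by
  rw [WithLp.prod_norm_eq_of_L2]; simp [elen]

lemma fourier_toEPlane (g : 𝓢(ℝ × ℝ, ℂ)) (ξ : EPlane) :
    𝓕 (toEPlane g) ξ = spatialFourier g ξ.ofLp := by
  rw [SchwartzMap.fourier_coe, Real.fourier_eq', spatialFourier, ← integral_ofLp]
  refine integral_congr_ae (.of_forall fun x => ?_)
  simp only [toEPlane_apply, smul_eq_mul, WithLp.prod_inner_apply]
  congr 2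
  simp
  ring

lemma toEPlane_lineDeriv (g : 𝓢(ℝ × ℝ, ℂ)) (e : ℝ × ℝ) :
    toEPlane (∂_{e} g) = ∂_{(WithLp.toLp 2 e : EPlane)} (toEPlane g) := by
  unfold toEPlane
  rw [SchwartzMap.lineDerivOp_compCLMOfContinuousLinearEquiv]
  rfl

lemma spatialFourier_lineDeriv (g : 𝓢(ℝ × ℝ, ℂ)) (e ξ : ℝ × ℝ) :
    spatialFourier (∂_{e} g : 𝓢(ℝ × ℝ, ℂ)) ξ =
      2 * Real.pi * Complex.I * ((ξ.1 * e.1 + ξ.2 * e.2 : ℝ) : ℂ) * spatialFourier g ξ := by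
  have h1 := fourier_toEPlane (∂_{e} g) (WithLp.toLp 2 ξ)
  have h2 := fourier_toEPlane g (WithLp.toLp 2 ξ)
  simp only at h1 h2
  have ht : (fun x : EPlane => inner ℝ x (WithLp.toLp 2 e)).HasTemperateGrowth :=
    ((innerSL ℝ).flip _).hasTemperateGrowth
  rw [← h1, ← h2, toEPlane_lineDeriv, SchwartzMap.fourier_lineDerivOp_eq, smul_apply,
    SchwartzMap.smulLeftCLM_apply_apply ht]
  simp [WithLp.prod_inner_apply]
  ring

lemma spatialFourier_comp_affine (g : 𝓢(ℝ × ℝ, ℂ)) {l : ℝ} (hl : 0 < l) (x ξ : ℝ × ℝ) :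
    spatialFourier (fun z => g (x + l⁻¹ • z)) ξ =
      (l ^ 2 : ℝ) * Complex.exp ((2 * Real.pi * l * (x.1 * ξ.1 + x.2 * ξ.2)) * Complex.I) *
        spatialFourier g (l • ξ) := by
  unfold spatialFourier
  have h := Measure.integral_comp_inv_smul (volume : Measure (ℝ × ℝ))
    (fun z => Complex.exp (-(2 * Real.pi * ((l • z).1 * ξ.1 + (l • z).2 * ξ.2)) * Complex.I)
      * g (x + z)) l
  have h' := integral_add_left_eq_self (μ := (volume : Measure (ℝ × ℝ)))
    (fun z => Complex.exp (-(2 * Real.pi * ((l • (z - x)).1 * ξ.1 + (l • (z - x)).2 * ξ.2)) *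
      Complex.I) * g z) x
  simp only [smul_inv_smul₀ hl.ne', add_sub_cancel_left] at h h'
  push_cast at h ⊢
  rw [h, h', mul_assoc, ← integral_const_mul]
  simp only [Module.finrank_prod, Module.finrank_self]
  rw [abs_of_pos (by positivity)]
  norm_num
  left
  refine integral_congr_ae (.of_forall fun z => ?_)
  simp only [← mul_assoc]
  rw [← Complex.exp_add]
  congr 2
  ring

/-- A smooth bump on the Euclidean plane equal to `1` on the ball of radius `2`. -/
def planeBump : ContDiffBump (0 : EPlane) := ⟨2, 3, by norm_num, by norm_num⟩

/-- The bump `planeBump` as a complex Schwartz function. -/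
def planeCutoff : 𝓢(EPlane, ℂ) :=
  HasCompactSupport.toSchwartzMap (f := Complex.ofRealCLM ∘ planeBump)
    (planeBump.hasCompactSupport.comp_left Complex.ofReal_zero)
    (Complex.ofRealCLM.contDiff.comp planeBump.contDiff)

lemma planeCutoff_eq_one {x : EPlane} (hx : ‖x‖ ≤ 2) : planeCutoff x = 1 := by
  change ((planeBump x : ℝ) : ℂ) = 1
  rw [ContDiffBump.one_of_mem_closedBall _ (by simpa [planeBump] using hx)]
  simp

/-- The reproducing kernel of Schwartz functions with Fourier support in the ball of radius `2`. -/
def bandKernel : 𝓢(ℝ × ℝ, ℂ) := ofEPlane (𝓕 planeCutoff)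

lemma apply_zero_eq_integral_bandKernel (h : 𝓢(ℝ × ℝ, ℂ))
    (hh : ∀ ξ, spatialFourier h ξ ≠ 0 → elen ξ ≤ 2) : h 0 = ∫ z, bandKernel z * h z := by
  have h1 : 𝓕⁻ (𝓕 (toEPlane h)) (0 : EPlane) = toEPlane h 0 := by simp
  have h2 : 𝓕⁻ (𝓕 (toEPlane h)) (0 : EPlane) = ∫ ξ, 𝓕 (toEPlane h) ξ := by
    rw [SchwartzMap.fourierInv_coe, Real.fourierInv_eq]
    simp
  have h3 : ∫ ξ, 𝓕 (toEPlane h) ξ = ∫ ξ, 𝓕 (toEPlane h) ξ * planeCutoff ξ := by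
    refine integral_congr_ae (.of_forall fun ξ => ?_)
    by_cases h0 : 𝓕 (toEPlane h) ξ = 0
    · simp [h0]
    · rw [fourier_toEPlane] at h0
      have := hh _ h0
      rw [← norm_toLp_eq_elen] at this
      simp only [planeCutoff_eq_one this, mul_one]
  rw [SchwartzMap.integral_fourier_mul_eq] at h3
  have h4 : h 0 = toEPlane h 0 := rfl
  rw [h4, ← h1, h2, h3, ← integral_ofLp]
  refine integral_congr_ae (.of_forall fun z => ?_)
  simp [bandKernel, ofEPlane_apply, toEPlane_apply, mul_comm]

lemma lineDeriv_zero_eq_integral_bandKernel (h : 𝓢(ℝ × ℝ, ℂ))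
    (hh : ∀ ξ, spatialFourier h ξ ≠ 0 → elen ξ ≤ 2) (e : ℝ × ℝ) :
    (∂_{e} h : 𝓢(ℝ × ℝ, ℂ)) 0 = - ∫ z, (∂_{e} bandKernel : 𝓢(ℝ × ℝ, ℂ)) z * h z := by
  rw [← SchwartzMap.integral_mul_lineDerivOp_right_eq_neg_left]
  refine apply_zero_eq_integral_bandKernel _ fun ξ hξ => hh ξ fun h0 => hξ ?_
  rw [spatialFourier_lineDeriv, h0, mul_zero]

/-- Composition of a Schwartz function with an affine dilation. -/
def affineComp (g : 𝓢(ℝ × ℝ, ℂ)) {l : ℝ} (hl : l ≠ 0) (x : ℝ × ℝ) : 𝓢(ℝ × ℝ, ℂ) :=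
  SchwartzMap.compCLMOfContinuousLinearEquiv ℂ
    (LinearEquiv.smulOfNeZero ℝ (ℝ × ℝ) l⁻¹ (inv_ne_zero hl)).toContinuousLinearEquiv
    (SchwartzMap.compSubConstCLM ℂ (-x) g)

lemma affineComp_apply (g : 𝓢(ℝ × ℝ, ℂ)) {l : ℝ} (hl : l ≠ 0) (x z : ℝ × ℝ) :
    affineComp g hl x z = g (x + l⁻¹ • z) := by
  rw [add_comm]
  simp [affineComp, SchwartzMap.compCLMOfContinuousLinearEquiv_apply]

lemma elen_smul {l : ℝ} (hl : 0 ≤ l) (ξ : ℝ × ℝ) : elen (l • ξ) = l * elen ξ := by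
  rw [← norm_toLp_eq_elen, ← norm_toLp_eq_elen, WithLp.toLp_smul, norm_smul, Real.norm_of_nonneg hl]

lemma affineComp_bandlimited (g : 𝓢(ℝ × ℝ, ℂ)) {l : ℝ} (hl : 0 < l) (x : ℝ × ℝ)
    (hg : ∀ ξ, spatialFourier g ξ ≠ 0 → elen ξ ≤ 2 * l) (ξ : ℝ × ℝ)
    (hξ : spatialFourier (affineComp g hl.ne' x) ξ ≠ 0) : elen ξ ≤ 2 := by
  have h : (affineComp g hl.ne' x : ℝ × ℝ → ℂ) = fun z => g (x + l⁻¹ • z) :=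
    funext (affineComp_apply g hl.ne' x)
  rw [h, spatialFourier_comp_affine g hl] at hξ
  have := hg _ (right_ne_zero_of_mul hξ)
  rw [elen_smul hl.le] at this
  nlinarith

/-- Reproducing formula for band-limited Schwartz functions. -/
lemma eq_integral_bandKernel (g : 𝓢(ℝ × ℝ, ℂ)) {l : ℝ} (hl : 0 < l)
    (hg : ∀ ξ, spatialFourier g ξ ≠ 0 → elen ξ ≤ 2 * l) (x : ℝ × ℝ) :
    g x = ∫ z, bandKernel z * g (x + l⁻¹ • z) := by
  have := apply_zero_eq_integral_bandKernel (affineComp g hl.ne' x)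
    (affineComp_bandlimited g hl x hg)
  simpa [affineComp_apply] using this

/-- Derivatives of band-limited Schwartz functions as convolutions. -/
lemma lineDeriv_eq_integral_bandKernel (g : 𝓢(ℝ × ℝ, ℂ)) {l : ℝ} (hl : 0 < l)
    (hg : ∀ ξ, spatialFourier g ξ ≠ 0 → elen ξ ≤ 2 * l) (e x : ℝ × ℝ) :
    (∂_{e} g : 𝓢(ℝ × ℝ, ℂ)) x =
      -(l * ∫ z, (∂_{e} bandKernel : 𝓢(ℝ × ℝ, ℂ)) z * g (x + l⁻¹ • z)) := by
  have h := lineDeriv_zero_eq_integral_bandKernel (affineComp g hl.ne' x)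
    (affineComp_bandlimited g hl x hg) e
  have h2 : (∂_{e} (affineComp g hl.ne' x) : 𝓢(ℝ × ℝ, ℂ)) 0 =
      (l : ℂ)⁻¹ * (∂_{e} g : 𝓢(ℝ × ℝ, ℂ)) x := by
    have hc : (affineComp g hl.ne' x : ℝ × ℝ → ℂ) = fun z => g (x + l⁻¹ • z) :=
      funext (affineComp_apply g hl.ne' x)
    rw [SchwartzMap.lineDerivOp_apply_eq_fderiv, SchwartzMap.lineDerivOp_apply_eq_fderiv, hc]
    have hd : HasFDerivAt (fun z : ℝ × ℝ => x + l⁻¹ • z)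
        (l⁻¹ • ContinuousLinearMap.id ℝ (ℝ × ℝ)) 0 :=
      ((hasFDerivAt_id (𝕜 := ℝ) (0 : ℝ × ℝ)).const_smul l⁻¹).const_add x
    have hgd : HasFDerivAt g (fderiv ℝ g x) (x + l⁻¹ • (0 : ℝ × ℝ)) := by
      simpa using (g.differentiableAt (x := x)).hasFDerivAt
    have := (hgd.comp (0 : ℝ × ℝ) hd).fderiv
    rw [Function.comp_def] at this
    rw [this]
    simp
  rw [h2] at h
  simp only [affineComp_apply] at h
  have hl' : (l : ℂ) ≠ 0 := by exact_mod_cast hl.ne'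
  rw [inv_mul_eq_iff_eq_mul₀ hl'] at h
  rw [h]
  ring

/-- Complex conjugate of a Schwartz function. -/
def conjSchwartz (g : 𝓢(ℝ × ℝ, ℂ)) : 𝓢(ℝ × ℝ, ℂ) :=
  SchwartzMap.postcompCLM (𝕜 := ℝ) (Complex.conjCLE : ℂ →L[ℝ] ℂ) g

lemma conjSchwartz_apply (g : 𝓢(ℝ × ℝ, ℂ)) (x : ℝ × ℝ) : conjSchwartz g x = conj (g x) := rfl

/-- Product of two Schwartz functions. -/
def mulSchwartz (f g : 𝓢(ℝ × ℝ, ℂ)) : 𝓢(ℝ × ℝ, ℂ) :=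
  SchwartzMap.pairing (ContinuousLinearMap.mul ℂ ℂ) f g

lemma mulSchwartz_apply (f g : 𝓢(ℝ × ℝ, ℂ)) (x : ℝ × ℝ) : mulSchwartz f g x = f x * g x := rfl

lemma spatialFourier_conj (g : 𝓢(ℝ × ℝ, ℂ)) (ξ : ℝ × ℝ) :
    spatialFourier (conjSchwartz g) ξ = conj (spatialFourier g (-ξ)) := by
  unfold spatialFourier
  rw [← integral_conj]
  refine integral_congr_ae (.of_forall fun x => ?_)
  simp only [conjSchwartz_apply, map_mul, ← Complex.exp_conj]
  congr 2
  simp [Complex.conj_ofNat]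
  ring

lemma spatialFourier_mul (f g : 𝓢(ℝ × ℝ, ℂ)) (ζ : ℝ × ℝ) :
    spatialFourier (mulSchwartz f g) ζ = ∫ ξ, spatialFourier f ξ * spatialFourier g (ζ - ξ) := by
  have h1 : toEPlane (mulSchwartz f g) =
      SchwartzMap.pairing (ContinuousLinearMap.mul ℂ ℂ) (toEPlane f) (toEPlane g) := rfl
  have h2 := SchwartzMap.fourier_convolution (ContinuousLinearMap.mul ℂ ℂ)
    (𝓕⁻ (toEPlane f)) (𝓕⁻ (toEPlane g))
  rw [FourierTransform.fourier_fourierInv_eq, FourierTransform.fourier_fourierInv_eq, ← h1] at h2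
  have h3 := fourier_toEPlane (mulSchwartz f g) (WithLp.toLp 2 ζ)
  simp only at h3
  rw [← h3, ← h2]
  have h4 : ∀ (q : 𝓢(EPlane, ℂ)) (x : EPlane), 𝓕 q x = 𝓕⁻ q (-x) := by
    intro q x
    rw [SchwartzMap.fourierInv_coe, SchwartzMap.fourier_coe, Real.fourierInv_eq_fourier_neg,
      neg_neg]
  rw [h4, FourierTransform.fourierInv_fourier_eq, SchwartzMap.convolution_apply, ← integral_ofLp,
    convolution_def, ← integral_neg_eq_self]
  refine integral_congr_ae (.of_forall fun x => ?_)
  simp only [ContinuousLinearMap.mul_apply']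
  rw [← h4, show -WithLp.toLp 2 ζ - -x = -(WithLp.toLp 2 ζ - x) by abel, ← h4,
    fourier_toEPlane, fourier_toEPlane]
  rfl

lemma elen_sub_le (ξ η : ℝ × ℝ) : elen (ξ - η) ≤ elen ξ + elen η := by
  simp only [← norm_toLp_eq_elen, WithLp.toLp_sub]
  exact norm_sub_le _ _

lemma elen_neg (ξ : ℝ × ℝ) : elen (-ξ) = elen ξ := by simp [elen]

lemma spatialFourier_mul_conj_support {f g : 𝓢(ℝ × ℝ, ℂ)} {a : ℝ}
    (hf : ∀ ξ, spatialFourier f ξ ≠ 0 → a ≤ elen ξ)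
    (hg : ∀ ξ, spatialFourier g ξ ≠ 0 → elen ξ ≤ a / 2) (ζ : ℝ × ℝ)
    (hζ : spatialFourier (mulSchwartz f (conjSchwartz g)) ζ ≠ 0) : a / 2 ≤ elen ζ := by
  by_contra! hlt
  refine hζ ?_
  rw [spatialFourier_mul]
  refine integral_eq_zero_of_ae (.of_forall fun ξ => ?_)
  by_contra h
  simp only [Pi.zero_apply, mul_eq_zero, not_or, spatialFourier_conj, map_eq_zero] at h
  have h1 := hf _ h.1
  have h2 := hg _ h.2
  have h3 := elen_sub_le ζ (ζ - ξ)
  rw [show ζ - (ζ - ξ) = ξ by abel] at h3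
  rw [elen_neg] at h2
  linarith

lemma lintegral_enorm_sq_spatialFourier (h : 𝓢(ℝ × ℝ, ℂ)) :
    ∫⁻ ξ, ‖spatialFourier h ξ‖ₑ ^ 2 = ∫⁻ x, ‖h x‖ₑ ^ 2 := by
  have key : ∀ q : 𝓢(EPlane, ℂ), ∫⁻ x, ‖q x‖ₑ ^ 2 = ENNReal.ofReal (∫ x, ‖q x‖ ^ 2) := by
    intro q
    rw [ofReal_integral_eq_lintegral_ofReal
      ((q.memLp 2 (volume : Measure EPlane)).integrable_norm_pow two_ne_zero)
      (.of_forall fun x => by positivity)]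
    refine lintegral_congr fun x => ?_
    rw [ENNReal.ofReal_pow (norm_nonneg _), ofReal_norm]
  have tr : ∀ F : ℝ × ℝ → ℝ≥0∞, ∫⁻ x : EPlane, F x.ofLp = ∫⁻ x, F x := fun F =>
    (WithLp.volume_preserving_ofLp ℝ ℝ).lintegral_comp_emb
      (MeasurableEquiv.toLp 2 (ℝ × ℝ)).symm.measurableEmbedding F
  rw [← tr, ← tr]
  have h1 := key (𝓕 (toEPlane h))
  rw [SchwartzMap.integral_norm_sq_fourier, ← key] at h1
  simpa only [fourier_toEPlane, toEPlane_apply] using h1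

lemma continuous_spatialFourier (h : 𝓢(ℝ × ℝ, ℂ)) : Continuous (spatialFourier h) := by
  have : spatialFourier h = fun ξ => 𝓕 (toEPlane h) (WithLp.toLp 2 ξ) :=
    funext fun ξ => (fourier_toEPlane h (WithLp.toLp 2 ξ)).symm
  rw [this]
  exact (𝓕 (toEPlane h)).continuous.comp (WithLp.prod_continuous_toLp 2 ℝ ℝ)

/-- A Poincaré inequality for Schwartz functions without low frequencies. -/
lemma lintegral_enorm_sq_le_of_highFrequency (h : 𝓢(ℝ × ℝ, ℂ)) {a : ℝ} (ha : 0 ≤ a)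
    (hh : ∀ ξ, spatialFourier h ξ ≠ 0 → a / 2 ≤ elen ξ) :
    ENNReal.ofReal a ^ 2 * ∫⁻ x, ‖h x‖ₑ ^ 2 ≤
      (∫⁻ x, ‖(∂_{((1, 0) : ℝ × ℝ)} h : 𝓢(ℝ × ℝ, ℂ)) x‖ₑ ^ 2) +
        ∫⁻ x, ‖(∂_{((0, 1) : ℝ × ℝ)} h : 𝓢(ℝ × ℝ, ℂ)) x‖ₑ ^ 2 := by
  rw [← lintegral_enorm_sq_spatialFourier, ← lintegral_enorm_sq_spatialFourier,
    ← lintegral_enorm_sq_spatialFourier, ← lintegral_const_mul' _ _ (by simp),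
    ← lintegral_add_left ((continuous_spatialFourier _).measurable.enorm.pow_const 2)]
  refine lintegral_mono fun ξ => ?_
  by_cases h0 : spatialFourier h ξ = 0
  · simp [h0]
  have h1 := hh ξ h0
  simp only [spatialFourier_lineDeriv, mul_one, mul_zero, add_zero, zero_add, enorm_mul, mul_pow]
  rw [← add_mul, ← mul_add]
  gcongr
  simp only [← ofReal_norm, ← ENNReal.ofReal_pow (norm_nonneg _),
    ← ENNReal.ofReal_pow ha]
  rw [← ENNReal.ofReal_mul (by positivity), ← ENNReal.ofReal_mul (by positivity),
    ← ENNReal.ofReal_add (by positivity) (by positivity),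
    ← ENNReal.ofReal_mul (by positivity)]
  refine ENNReal.ofReal_le_ofReal ?_
  have h2 : elen ξ ^ 2 = ξ.1 ^ 2 + ξ.2 ^ 2 := Real.sq_sqrt (by positivity)
  have h3 : (a / 2) ^ 2 ≤ elen ξ ^ 2 := pow_le_pow_left₀ (by positivity) h1 2
  have h4 := Real.pi_gt_three
  simp only [Complex.norm_real, Complex.norm_I, Complex.norm_ofNat, Real.norm_eq_abs, sq_abs]
  nlinarith [mul_le_mul h4.le h4.le (by norm_num) Real.pi_pos.le, sq_nonneg ξ.1, sq_nonneg ξ.2]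

/-- The derivative of a space-time function in the spatial direction `e`. -/
def spaceDeriv (e : ℝ × ℝ) (u : ℝ × ℝ × ℝ → ℂ) (p : ℝ × ℝ × ℝ) : ℂ := fderiv ℝ u p (0, e)

/-- Smooth space-time functions whose time slices are Schwartz with spatial frequencies at most
`2 * l`. -/
structure BandLimited (l : ℝ) (u : ℝ × ℝ × ℝ → ℂ) : Prop where
  contDiff : ContDiff ℝ (⊤ : ℕ∞) u
  slice : ∀ t : ℝ, ∃ g : 𝓢(ℝ × ℝ, ℂ), ∀ x : ℝ × ℝ, g x = u (t, x)
  elen_le : ∀ (t : ℝ) (ξ : ℝ × ℝ), spatialFourier (fun x => u (t, x)) ξ ≠ 0 → elen ξ ≤ 2 * l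

lemma spaceDeriv_slice {u : ℝ × ℝ × ℝ → ℂ} (hu : ContDiff ℝ (⊤ : ℕ∞) u) {t : ℝ}
    {g : 𝓢(ℝ × ℝ, ℂ)} (hg : ∀ x, g x = u (t, x)) (e x : ℝ × ℝ) :
    (∂_{e} g : 𝓢(ℝ × ℝ, ℂ)) x = spaceDeriv e u (t, x) := by
  have h1 : HasFDerivAt (fun x : ℝ × ℝ => (t, x)) (ContinuousLinearMap.inr ℝ ℝ (ℝ × ℝ)) x :=
    hasFDerivAt_prodMk_right t x
  have h2 : HasFDerivAt u (fderiv ℝ u (t, x)) (t, x) :=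
    (hu.differentiable (by simp) (t, x)).hasFDerivAt
  have h3 := (h2.comp x h1).fderiv
  have h4 : (g : ℝ × ℝ → ℂ) = u ∘ fun x => (t, x) := funext hg
  rw [SchwartzMap.lineDerivOp_apply_eq_fderiv, h4, h3]
  simp [spaceDeriv]

lemma contDiff_fderiv_const_apply {E F : Type*} [NormedAddCommGroup E] [NormedSpace ℝ E]
    [NormedAddCommGroup F] [NormedSpace ℝ F] {u : E → F} (hu : ContDiff ℝ (⊤ : ℕ∞) u) (d : E) : ContDiff ℝ (⊤ : ℕ∞) fun p => fderiv ℝ u p d :=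
  (hu.fderiv_right (m := (⊤ : ℕ∞)) (by simp)).clm_apply contDiff_const

lemma BandLimited.spaceDeriv {l : ℝ} {u : ℝ × ℝ × ℝ → ℂ} (hu : BandLimited l u) (e : ℝ × ℝ) :
    BandLimited l (spaceDeriv e u) where
  contDiff := contDiff_fderiv_const_apply hu.contDiff _
  slice t := by
    obtain ⟨g, hg⟩ := hu.slice t
    exact ⟨∂_{e} g, spaceDeriv_slice hu.contDiff hg e⟩
  elen_le t ξ hξ := by
    obtain ⟨g, hg⟩ := hu.slice t
    rw [← funext (spaceDeriv_slice hu.contDiff hg e)] at hξ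
    have := spatialFourier_lineDeriv g e ξ
    refine hu.elen_le t ξ fun h0 => hξ ?_
    rw [← funext hg] at h0
    rw [this, h0, mul_zero]

/-- A majorant of the reproducing kernel and its derivative. -/
def kernelMajorant (z : ℝ × ℝ) : ℝ≥0∞ :=
  ‖(∂_{((1, 0) : ℝ × ℝ)} bandKernel : 𝓢(ℝ × ℝ, ℂ)) z‖ₑ +
    ‖(∂_{((0, 1) : ℝ × ℝ)} bandKernel : 𝓢(ℝ × ℝ, ℂ)) z‖ₑ

lemma measurable_kernelMajorant : Measurable kernelMajorant :=
  (SchwartzMap.continuous _).measurable.enorm.add (SchwartzMap.continuous _).measurable.enorm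

/-- The mass of the kernel majorant. -/
def kernelMass : ℝ≥0∞ := ∫⁻ z, kernelMajorant z

lemma kernelMass_ne_top : kernelMass ≠ ∞ := by
  unfold kernelMass kernelMajorant
  rw [lintegral_add_left (SchwartzMap.continuous _).measurable.enorm]
  exact ENNReal.add_ne_top.2 ⟨(SchwartzMap.integrable _).2.ne, (SchwartzMap.integrable _).2.ne⟩

/-- The two coordinate directions of the plane. -/
def IsAxis (e : ℝ × ℝ) : Prop := e = (1, 0) ∨ e = (0, 1)

lemma BandLimited.enorm_spaceDeriv_le {l : ℝ} {u : ℝ × ℝ × ℝ → ℂ} (hu : BandLimited l u)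
    (hl : 0 < l) {e : ℝ × ℝ} (he : IsAxis e) (t : ℝ) (x : ℝ × ℝ) :
    ‖_root_.spaceDeriv e u (t, x)‖ₑ ≤
      ENNReal.ofReal l * ∫⁻ z, kernelMajorant z * ‖u (t, x + l⁻¹ • z)‖ₑ := by
  obtain ⟨g, hg⟩ := hu.slice t
  have hb := hu.elen_le t
  rw [← funext hg] at hb
  rw [← spaceDeriv_slice hu.contDiff hg, lineDeriv_eq_integral_bandKernel g hl hb, enorm_neg,
    enorm_mul]
  refine mul_le_mul' ?_ ((enorm_integral_le_lintegral_enorm _).trans (lintegral_mono fun z => ?_))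
  · rw [← ofReal_norm, Complex.norm_real, Real.norm_of_nonneg hl.le]
  · rw [enorm_mul, hg]
    refine mul_le_mul' ?_ le_rfl
    rcases he with rfl | rfl
    · exact le_self_add
    · exact le_add_self

lemma BandLimited.eq_integral {l : ℝ} {u : ℝ × ℝ × ℝ → ℂ} (hu : BandLimited l u)
    (hl : 0 < l) (t : ℝ) (x : ℝ × ℝ) :
    u (t, x) = ∫ z, bandKernel z * u (t, x + l⁻¹ • z) := by
  obtain ⟨g, hg⟩ := hu.slice t
  have hb := hu.elen_le t
  rw [← funext hg] at hb
  simpa only [hg] using eq_integral_bandKernel g hl hb x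

lemma sq_lintegral_mul_le {α : Type*} [MeasurableSpace α] {μ : Measure α} {f g : α → ℝ≥0∞}
    (hf : AEMeasurable f μ) (hg : AEMeasurable g μ) :
    (∫⁻ a, f a * g a ∂μ) ^ 2 ≤ (∫⁻ a, f a ^ 2 ∂μ) * ∫⁻ a, g a ^ 2 ∂μ := by
  have h := ENNReal.lintegral_mul_le_Lp_mul_Lq μ Real.HolderConjugate.two_two hf hg
  have := pow_le_pow_left₀ (zero_le) h 2
  refine this.trans_eq ?_
  rw [mul_pow, ← ENNReal.rpow_natCast, ← ENNReal.rpow_natCast, ← ENNReal.rpow_mul,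
    ← ENNReal.rpow_mul]
  norm_num

/-- The square of the `L^∞_t L²_x` norm. -/
def massSup (u : ℝ × ℝ × ℝ → ℂ) : ℝ≥0∞ := ⨆ t : ℝ, ∫⁻ x : ℝ × ℝ, ‖u (t, x)‖ₑ ^ 2

lemma lintegral_le_massSup (u : ℝ × ℝ × ℝ → ℂ) (t : ℝ) :
    ∫⁻ x : ℝ × ℝ, ‖u (t, x)‖ₑ ^ 2 ≤ massSup u :=
  le_iSup (fun t : ℝ => ∫⁻ x : ℝ × ℝ, ‖u (t, x)‖ₑ ^ 2) t

lemma massSup_eq (u : ℝ × ℝ × ℝ → ℂ) : massSup u = LinfL2 u ^ 2 := by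
  unfold massSup LinfL2
  rw [ENNReal.iSup_pow_of_ne_zero two_ne_zero]
  congr 1 with t
  rw [← ENNReal.rpow_natCast, ← ENNReal.rpow_mul]
  norm_num
  rfl

lemma BandLimited.massSup_spaceDeriv_le {l : ℝ} {u : ℝ × ℝ × ℝ → ℂ} (hu : BandLimited l u)
    (hl : 0 < l) {e : ℝ × ℝ} (he : IsAxis e) :
    massSup (_root_.spaceDeriv e u) ≤ (ENNReal.ofReal l * kernelMass) ^ 2 * massSup u := by
  refine iSup_le fun t => ?_
  have hm : Measurable fun q : (ℝ × ℝ) × (ℝ × ℝ) => ‖u (t, q.1 + l⁻¹ • q.2)‖ₑ := by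
    have := hu.contDiff.continuous
    exact (by fun_prop : Continuous fun q : (ℝ × ℝ) × (ℝ × ℝ) =>
      u (t, q.1 + l⁻¹ • q.2)).measurable.enorm
  have hk := measurable_kernelMajorant
  calc ∫⁻ x : ℝ × ℝ, ‖_root_.spaceDeriv e u (t, x)‖ₑ ^ 2
      ≤ ∫⁻ x : ℝ × ℝ, ENNReal.ofReal l ^ 2 *
          (kernelMass * ∫⁻ z, kernelMajorant z * ‖u (t, x + l⁻¹ • z)‖ₑ ^ 2) := by
        refine lintegral_mono fun x => ?_
        refine (pow_le_pow_left₀ (zero_le) (hu.enorm_spaceDeriv_le hl he t x) 2).trans ?_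
        rw [mul_pow]
        gcongr
        have h2 := hm.comp (measurable_prodMk_left (x := x))
        have h := sq_lintegral_mul_le (μ := volume) (f := fun z => kernelMajorant z ^ (1 / 2 : ℝ))
          (g := fun z => kernelMajorant z ^ (1 / 2 : ℝ) * ‖u (t, x + l⁻¹ • z)‖ₑ)
          (hk.pow_const _).aemeasurable ((hk.pow_const _).mul h2).aemeasurable
        have e : ∀ a : ℝ≥0∞, a ^ (1 / 2 : ℝ) * a ^ (1 / 2 : ℝ) = a := fun a => by
          rw [← ENNReal.rpow_add_of_nonneg _ _ (by norm_num) (by norm_num)]; norm_num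
        simpa only [mul_pow, sq (_ ^ (1 / 2 : ℝ)), ← mul_assoc, e, kernelMass] using h
    _ = ENNReal.ofReal l ^ 2 * (kernelMass *
          ∫⁻ z, kernelMajorant z * ∫⁻ x : ℝ × ℝ, ‖u (t, x + l⁻¹ • z)‖ₑ ^ 2) := by
        rw [lintegral_const_mul' _ _ (by simp), lintegral_const_mul' _ _ kernelMass_ne_top,
          lintegral_lintegral_swap]
        · congr 2
          refine lintegral_congr fun z => ?_
          rw [lintegral_const_mul]
          exact (hm.comp (measurable_prodMk_right (y := z))).pow_const 2
        · exact ((hk.comp measurable_snd).mul (hm.pow_const 2)).aemeasurable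
    _ ≤ ENNReal.ofReal l ^ 2 * (kernelMass * ∫⁻ z, kernelMajorant z * massSup u) := by
        gcongr with z
        rw [lintegral_add_right_eq_self (fun x => ‖u (t, x)‖ₑ ^ 2)]
        exact lintegral_le_massSup u t
    _ = (ENNReal.ofReal l * kernelMass) ^ 2 * massSup u := by
        rw [lintegral_mul_const _ hk]
        change _ * (_ * (kernelMass * _)) = _
        ring

lemma lintegral_le_interact (u N : ℝ × ℝ × ℝ → ℂ) (y : ℝ × ℝ) :
    ∫⁻ p : ℝ × ℝ × ℝ, ‖u (p.1, p.2 + y)‖ₑ * ‖N p‖ₑ ≤ interact u N := by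
  refine le_trans (le_of_eq ?_) (le_iSup _ (-y))
  refine lintegral_congr fun p => ?_
  simp only [Prod.fst_neg, Prod.snd_neg, sub_neg_eq_add]
  rfl

lemma BandLimited.interact_spaceDeriv_le {l : ℝ} {u : ℝ × ℝ × ℝ → ℂ} (hu : BandLimited l u)
    (hl : 0 < l) {e : ℝ × ℝ} (he : IsAxis e) {N : ℝ × ℝ × ℝ → ℂ} (hN : Continuous N) :
    interact (_root_.spaceDeriv e u) N ≤ ENNReal.ofReal l * kernelMass * interact u N := by
  refine iSup_le fun y => ?_
  have hk := measurable_kernelMajorant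
  have hm : Measurable fun q : (ℝ × ℝ × ℝ) × (ℝ × ℝ) =>
      ‖u (q.1.1, q.1.2 + (-y + l⁻¹ • q.2))‖ₑ := by
    have := hu.contDiff.continuous
    exact (by fun_prop : Continuous fun q : (ℝ × ℝ × ℝ) × (ℝ × ℝ) =>
      u (q.1.1, q.1.2 + (-y + l⁻¹ • q.2))).measurable.enorm
  have hNm : Measurable fun p => ‖N p‖ₑ := hN.measurable.enorm
  calc ∫⁻ p : ℝ × ℝ × ℝ, ‖_root_.spaceDeriv e u (p.1, p.2.1 - y.1, p.2.2 - y.2)‖ₑ * ‖N p‖ₑ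
      ≤ ∫⁻ p : ℝ × ℝ × ℝ, ENNReal.ofReal l *
          ∫⁻ z, kernelMajorant z * (‖u (p.1, p.2 + (-y + l⁻¹ • z))‖ₑ * ‖N p‖ₑ) := by
        refine lintegral_mono fun p => ?_
        refine (mul_le_mul' (hu.enorm_spaceDeriv_le hl he p.1 (p.2 - y)) le_rfl).trans ?_
        rw [mul_assoc, ← lintegral_mul_const' _ _ (by simp)]
        simp only [mul_assoc, sub_eq_add_neg, add_assoc, le_refl]
    _ = ENNReal.ofReal l * ∫⁻ z, kernelMajorant z *
          ∫⁻ p : ℝ × ℝ × ℝ, ‖u (p.1, p.2 + (-y + l⁻¹ • z))‖ₑ * ‖N p‖ₑ := by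
        rw [lintegral_const_mul' _ _ (by simp), lintegral_lintegral_swap]
        · congr 1
          refine lintegral_congr fun z => ?_
          rw [lintegral_const_mul]
          exact (hm.comp (measurable_prodMk_right (y := z))).mul hNm
        · exact ((hk.comp measurable_snd).mul (hm.mul (hNm.comp measurable_fst))).aemeasurable
    _ ≤ ENNReal.ofReal l * ∫⁻ z, kernelMajorant z * interact u N := by
        gcongr with z
        exact lintegral_le_interact u N _
    _ = _ := by
        rw [lintegral_mul_const _ hk, mul_assoc]; rfl

section DirDeriv

variable {E : Type*} [NormedAddCommGroup E] [NormedSpace ℝ E]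

/-- The derivative of `f` in the direction `e`. -/
def dirDeriv {F : Type*} [NormedAddCommGroup F] [NormedSpace ℝ F] (e : E) (f : E → F) (p : E) : F :=
  fderiv ℝ f p e

lemma ContDiff.dirDeriv {F : Type*} [NormedAddCommGroup F] [NormedSpace ℝ F] {f : E → F}
    (hf : ContDiff ℝ (⊤ : ℕ∞) f) (e : E) : ContDiff ℝ (⊤ : ℕ∞) (dirDeriv e f) :=
  contDiff_fderiv_const_apply hf e

lemma HasCompactSupport.dirDeriv {F : Type*} [NormedAddCommGroup F] [NormedSpace ℝ F] {f : E → F}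
    (hf : HasCompactSupport f) (e : E) : HasCompactSupport (dirDeriv e f) :=
  hf.fderiv_apply ℝ e

lemma dirDeriv_mul {f g : E → ℂ} (hf : ContDiff ℝ (⊤ : ℕ∞) f) (hg : ContDiff ℝ (⊤ : ℕ∞) g) (e p : E) :
    dirDeriv e (fun x => f x * g x) p = dirDeriv e f p * g p + f p * dirDeriv e g p := by
  unfold dirDeriv
  rw [fderiv_fun_mul (hf.differentiable (by simp) p) (hg.differentiable (by simp) p)]
  simp
  ring

lemma dirDeriv_add {f g : E → ℂ} (hf : ContDiff ℝ (⊤ : ℕ∞) f) (hg : ContDiff ℝ (⊤ : ℕ∞) g) (e p : E) :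
    dirDeriv e (fun x => f x + g x) p = dirDeriv e f p + dirDeriv e g p := by
  unfold dirDeriv
  rw [fderiv_fun_add (hf.differentiable (by simp) p) (hg.differentiable (by simp) p)]
  rfl

lemma dirDeriv_sub {f g : E → ℂ} (hf : ContDiff ℝ (⊤ : ℕ∞) f) (hg : ContDiff ℝ (⊤ : ℕ∞) g) (e p : E) :
    dirDeriv e (fun x => f x - g x) p = dirDeriv e f p - dirDeriv e g p := by
  unfold dirDeriv
  rw [fderiv_fun_sub (hf.differentiable (by simp) p) (hg.differentiable (by simp) p)]
  rfl

lemma dirDeriv_const_mul {f : E → ℂ} (hf : ContDiff ℝ (⊤ : ℕ∞) f) (c : ℂ) (e p : E) :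
    dirDeriv e (fun x => c * f x) p = c * dirDeriv e f p := by
  unfold dirDeriv
  rw [fderiv_const_mul (hf.differentiable (by simp) p)]
  rfl

lemma dirDeriv_conj {f : E → ℂ} (hf : ContDiff ℝ (⊤ : ℕ∞) f) (e p : E) :
    dirDeriv e (fun x => conj (f x)) p = conj (dirDeriv e f p) := by
  have h := (Complex.conjCLE : ℂ →L[ℝ] ℂ).hasFDerivAt.comp p
    (hf.differentiable (by simp) p).hasFDerivAt
  have h2 := h.fderiv
  unfold dirDeriv
  rw [show (fun x => conj (f x)) = (Complex.conjCLE : ℂ →L[ℝ] ℂ) ∘ f from rfl, h2]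
  rfl

lemma dirDeriv_ofReal {f : E → ℝ} (hf : ContDiff ℝ (⊤ : ℕ∞) f) (e p : E) :
    dirDeriv e (fun x => (f x : ℂ)) p = ((dirDeriv e f p : ℝ) : ℂ) := by
  have h := Complex.ofRealCLM.hasFDerivAt.comp p (hf.differentiable (by simp) p).hasFDerivAt
  have h2 := h.fderiv
  unfold dirDeriv
  rw [show (fun x => (f x : ℂ)) = Complex.ofRealCLM ∘ f from rfl, h2]
  rfl

lemma dirDeriv_comm {f : E → ℂ} (hf : ContDiff ℝ (⊤ : ℕ∞) f) (d e p : E) :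
    dirDeriv e (dirDeriv d f) p = dirDeriv d (dirDeriv e f) p := by
  have hs : IsSymmSndFDerivAt ℝ f p :=
    hf.contDiffAt.isSymmSndFDerivAt (by
      simpa using WithTop.coe_le_coe.2 (le_top : (2 : ℕ∞) ≤ ⊤))
  have hd : DifferentiableAt ℝ (fderiv ℝ f) p :=
    (hf.fderiv_right (m := (⊤ : ℕ∞)) (by simp)).differentiable (by simp) p
  have key : ∀ a b : E, dirDeriv a (dirDeriv b f) p = fderiv ℝ (fderiv ℝ f) p a b := by
    intro a b
    unfold dirDeriv
    rw [fderiv_clm_apply hd (differentiableAt_const b)]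
    simp
  rw [key, key, hs.eq]

lemma dirDeriv_conj_eq {f : E → ℂ} (hf : ContDiff ℝ (⊤ : ℕ∞) f) (e : E) :
    dirDeriv e (fun x => conj (f x)) = fun x => conj (dirDeriv e f x) :=
  funext (dirDeriv_conj hf e)

/-- The divergence identity behind the bilinear virial estimate. -/
lemma bilinear_divergence_identity {W V : E → ℂ} (hW : ContDiff ℝ (⊤ : ℕ∞) W)
    (hV : ContDiff ℝ (⊤ : ℕ∞) V) {σ : ℂ} (hσ : σ * σ = 1) (τ d d' p q x : E) :
    dirDeriv d' (fun x => dirDeriv d V x * dirDeriv d W x) x +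
      dirDeriv τ (fun x => σ / (2 * Complex.I) * (V x * dirDeriv d W x - W x * dirDeriv d V x)) x +
      dirDeriv d (fun x => (-σ / (2 * Complex.I)) * (V x * dirDeriv τ W x - W x * dirDeriv τ V x) +
        (dirDeriv p V x * dirDeriv p W x - dirDeriv q V x * dirDeriv q W x)) x +
      dirDeriv p (fun x => (-1) * (dirDeriv p V x * dirDeriv d W x +
        dirDeriv p W x * dirDeriv d V x)) x +
      dirDeriv q (fun x => dirDeriv q V x * dirDeriv d W x + dirDeriv q W x * dirDeriv d V x) x =
    σ * ((-Complex.I * dirDeriv τ V x + σ * (dirDeriv d' (dirDeriv d V) x -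
        dirDeriv p (dirDeriv p V) x + dirDeriv q (dirDeriv q V) x)) * dirDeriv d W x +
      (Complex.I * dirDeriv τ W x + σ * (dirDeriv d' (dirDeriv d W) x -
        dirDeriv p (dirDeriv p W) x + dirDeriv q (dirDeriv q W) x)) * dirDeriv d V x) := by
  have W1 := hW.dirDeriv
  have V1 := hV.dirDeriv
  rw [dirDeriv_mul (V1 _) (W1 _),
    dirDeriv_const_mul ((hV.mul (W1 _)).sub (hW.mul (V1 _))),
    dirDeriv_sub (hV.mul (W1 _)) (hW.mul (V1 _)), dirDeriv_mul hV (W1 _), dirDeriv_mul hW (V1 _),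
    dirDeriv_add (contDiff_const.mul ((hV.mul (W1 _)).sub (hW.mul (V1 _))))
      (((V1 _).mul (W1 _)).sub ((V1 _).mul (W1 _))),
    dirDeriv_const_mul ((hV.mul (W1 _)).sub (hW.mul (V1 _))),
    dirDeriv_sub (hV.mul (W1 _)) (hW.mul (V1 _)), dirDeriv_mul hV (W1 _), dirDeriv_mul hW (V1 _),
    dirDeriv_sub ((V1 _).mul (W1 _)) ((V1 _).mul (W1 _)), dirDeriv_mul (V1 _) (W1 _),
    dirDeriv_mul (V1 _) (W1 _),
    dirDeriv_const_mul (((V1 _).mul (W1 _)).add ((W1 _).mul (V1 _))),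
    dirDeriv_add ((V1 _).mul (W1 _)) ((W1 _).mul (V1 _)), dirDeriv_mul (V1 _) (W1 _),
    dirDeriv_mul (W1 _) (V1 _),
    dirDeriv_add ((V1 _).mul (W1 _)) ((W1 _).mul (V1 _)), dirDeriv_mul (V1 _) (W1 _),
    dirDeriv_mul (W1 _) (V1 _)]
  rw [dirDeriv_comm hW d τ, dirDeriv_comm hV d τ, dirDeriv_comm hW d p, dirDeriv_comm hV d p,
    dirDeriv_comm hW d q, dirDeriv_comm hV d q]
  have hI : (1 : ℂ) / (2 * Complex.I) = -Complex.I / 2 := by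
    rw [div_eq_div_iff (by simp) (by simp)]
    linear_combination (2 : ℂ) * Complex.I_mul_I
  have h1 : σ / (2 * Complex.I) = -σ * Complex.I / 2 := by
    rw [div_eq_mul_one_div, hI]; ring
  have h2 : -σ / (2 * Complex.I) = σ * Complex.I / 2 := by
    rw [div_eq_mul_one_div, hI]; ring
  rw [h1, h2]
  linear_combination (-1 : ℂ) * ((dirDeriv d' (dirDeriv d V) x -
        dirDeriv p (dirDeriv p V) x + dirDeriv q (dirDeriv q V) x) * dirDeriv d W x +
      (dirDeriv d' (dirDeriv d W) x -
        dirDeriv p (dirDeriv p W) x + dirDeriv q (dirDeriv q W) x) * dirDeriv d V x) * hσ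

variable [FiniteDimensional ℝ E] [MeasurableSpace E] [BorelSpace E] (μ : Measure E)
  [μ.IsAddHaarMeasure]

lemma integral_dirDeriv_eq_zero {f : E → ℂ} (hf : ContDiff ℝ (⊤ : ℕ∞) f)
    (hc : HasCompactSupport f) (e : E) : ∫ x, dirDeriv e f x ∂μ = 0 := by
  have h := integral_smul_fderiv_eq_neg_fderiv_smul_of_integrable (μ := μ) (𝕜 := ℝ) (v := e)
    (f := fun _ : E => (1 : ℝ)) (g := f)
    (by simp)
    (by simpa [← dirDeriv.eq_1] using ((hf.dirDeriv e).continuous.integrable_of_hasCompactSupport (hc.dirDeriv e)))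
    (by simpa using (hf.continuous.integrable_of_hasCompactSupport hc))
    (fun x _ => differentiableAt_const _) (fun x _ => hf.differentiable (by simp) x)
  simpa [dirDeriv] using h

lemma enorm_conj (z : ℂ) : ‖conj z‖ₑ = ‖z‖ₑ := by
  rw [← ofReal_norm, ← ofReal_norm, RCLike.norm_conj]

/-- A bilinear virial (Morawetz) inequality with a general compactly supported weight. -/
lemma bilinear_virial_le {W F : E → ℂ} {b G : E → ℝ} (hW : ContDiff ℝ (⊤ : ℕ∞) W)
    (hb : ContDiff ℝ (⊤ : ℕ∞) b) (hbc : HasCompactSupport b) (hG : ∀ x, 0 ≤ G x)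
    (hGc : Continuous G) (hGs : HasCompactSupport G) {σ : ℂ} (hσ : σ = 1 ∨ σ = -1)
    (τ d d' p q : E)
    (hF : ∀ x, F x = Complex.I * dirDeriv τ W x + σ * (dirDeriv d' (dirDeriv d W) x -
      dirDeriv p (dirDeriv p W) x + dirDeriv q (dirDeriv q W) x)) :
    ∫⁻ x, ENNReal.ofReal (G x) * ‖dirDeriv d W x‖ₑ ^ 2 ∂μ ≤
      ∫⁻ x, (‖dirDeriv d' b x - G x‖ₑ * ‖dirDeriv d W x‖ₑ ^ 2 +
        ‖dirDeriv τ b x‖ₑ * (‖W x‖ₑ * ‖dirDeriv d W x‖ₑ) +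
        ‖dirDeriv d b x‖ₑ * (‖W x‖ₑ * ‖dirDeriv τ W x‖ₑ +
          (‖dirDeriv p W x‖ₑ ^ 2 + ‖dirDeriv q W x‖ₑ ^ 2)) +
        ‖dirDeriv p b x‖ₑ * (2 * (‖dirDeriv p W x‖ₑ * ‖dirDeriv d W x‖ₑ)) +
        ‖dirDeriv q b x‖ₑ * (2 * (‖dirDeriv q W x‖ₑ * ‖dirDeriv d W x‖ₑ)) +
        ‖b x‖ₑ * (2 * (‖F x‖ₑ * ‖dirDeriv d W x‖ₑ))) ∂μ := by
  have hσσ : σ * σ = 1 := by rcases hσ with rfl | rfl <;> norm_num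
  have hσn : ‖σ‖ₑ = 1 := by rcases hσ with rfl | rfl <;> simp
  have hσc : conj σ = σ := by rcases hσ with rfl | rfl <;> simp
  have hIn : ‖Complex.I‖ₑ = 1 := by rw [← ofReal_norm]; simp
  obtain ⟨V, hV⟩ : ∃ V : E → ℂ, V = fun x => conj (W x) := ⟨_, rfl⟩
  have hVs : ContDiff ℝ (⊤ : ℕ∞) V := by
    rw [hV]; exact (Complex.conjCLE : ℂ →L[ℝ] ℂ).contDiff.comp hW
  have hVd : ∀ e, dirDeriv e V = fun x => conj (dirDeriv e W x) := fun e => by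
    rw [hV]; exact dirDeriv_conj_eq hW e
  have hVdd : ∀ e e', dirDeriv e' (dirDeriv e V) = fun x => conj (dirDeriv e' (dirDeriv e W) x) :=
    fun e e' => by rw [hVd]; exact dirDeriv_conj_eq (hW.dirDeriv e) e'
  have W1 := hW.dirDeriv
  have V1 := hVs.dirDeriv
  have hbC : ContDiff ℝ (⊤ : ℕ∞) fun x => (b x : ℂ) := Complex.ofRealCLM.contDiff.comp hb
  have hbCc : HasCompactSupport fun x => (b x : ℂ) := hbc.comp_left (g := Complex.ofReal) (by simp)
  have id := bilinear_divergence_identity hW hVs hσσ τ d d' p q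
  set X₁ : E → ℂ := fun x => dirDeriv d V x * dirDeriv d W x with hX₁
  set X₂ : E → ℂ := fun x =>
    σ / (2 * Complex.I) * (V x * dirDeriv d W x - W x * dirDeriv d V x) with hX₂
  set X₃ : E → ℂ := fun x =>
    (-σ / (2 * Complex.I)) * (V x * dirDeriv τ W x - W x * dirDeriv τ V x) +
      (dirDeriv p V x * dirDeriv p W x - dirDeriv q V x * dirDeriv q W x) with hX₃
  set X₄ : E → ℂ := fun x => (-1) * (dirDeriv p V x * dirDeriv d W x +
        dirDeriv p W x * dirDeriv d V x) with hX₄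
  set X₅ : E → ℂ := fun x =>
    dirDeriv q V x * dirDeriv d W x + dirDeriv q W x * dirDeriv d V x with hX₅
  have s₁ : ContDiff ℝ (⊤ : ℕ∞) X₁ := (V1 _).mul (W1 _)
  have s₂ : ContDiff ℝ (⊤ : ℕ∞) X₂ :=
    contDiff_const.mul ((hVs.mul (W1 _)).sub (hW.mul (V1 _)))
  have s₃ : ContDiff ℝ (⊤ : ℕ∞) X₃ :=
    (contDiff_const.mul ((hVs.mul (W1 _)).sub (hW.mul (V1 _)))).add
      (((V1 _).mul (W1 _)).sub ((V1 _).mul (W1 _)))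
  have s₄ : ContDiff ℝ (⊤ : ℕ∞) X₄ :=
    contDiff_const.mul (((V1 _).mul (W1 _)).add ((W1 _).mul (V1 _)))
  have s₅ : ContDiff ℝ (⊤ : ℕ∞) X₅ := ((V1 _).mul (W1 _)).add ((W1 _).mul (V1 _))
  have h_int : ∀ {X : E → ℂ}, ContDiff ℝ (⊤ : ℕ∞) X → ∀ e,
      Integrable (dirDeriv e fun x => (b x : ℂ) * X x) μ := fun hX e =>
    ((hbC.mul hX).dirDeriv e).continuous.integrable_of_hasCompactSupport
      ((hbCc.mul_right).dirDeriv e)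
  have hzero : ∀ {X : E → ℂ}, ContDiff ℝ (⊤ : ℕ∞) X → ∀ e,
      ∫ x, dirDeriv e (fun x => (b x : ℂ) * X x) x ∂μ = 0 := fun hX e =>
    integral_dirDeriv_eq_zero μ (hbC.mul hX) hbCc.mul_right e
  have hprod : ∀ {X : E → ℂ}, ContDiff ℝ (⊤ : ℕ∞) X → ∀ e x,
      dirDeriv e (fun x => (b x : ℂ) * X x) x = (dirDeriv e b x : ℝ) * X x + b x * dirDeriv e X x :=
    fun hX e x => by rw [dirDeriv_mul hbC hX, dirDeriv_ofReal hb]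
  set R : E → ℂ := fun x => dirDeriv d' (fun x => (b x : ℂ) * X₁ x) x +
    dirDeriv τ (fun x => (b x : ℂ) * X₂ x) x + dirDeriv d (fun x => (b x : ℂ) * X₃ x) x +
    dirDeriv p (fun x => (b x : ℂ) * X₄ x) x + dirDeriv q (fun x => (b x : ℂ) * X₅ x) x with hR
  have i₁ := h_int s₁ d'
  have i₂ := i₁.add (h_int s₂ τ)
  have i₃ := i₂.add (h_int s₃ d)
  have i₄ := i₃.add (h_int s₄ p)
  have iR : Integrable R μ := i₄.add (h_int s₅ q)
  have hR0 : ∫ x, R x ∂μ = 0 := by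
    have e := integral_add i₄ (h_int s₅ q)
    rw [integral_add' i₃ (h_int s₄ p), integral_add' i₂ (h_int s₃ d),
      integral_add' i₁ (h_int s₂ τ)] at e
    simpa [hzero s₁, hzero s₂, hzero s₃, hzero s₄, hzero s₅] using e
  have iG : Integrable (fun x => (G x : ℂ) * X₁ x) μ := by
    refine Continuous.integrable_of_hasCompactSupport
      ((Complex.continuous_ofReal.comp hGc).mul s₁.continuous) ?_
    exact (hGs.comp_left (g := Complex.ofReal) (by simp)).mul_right
  have hX₁n : ∀ x, X₁ x = ((‖dirDeriv d W x‖ ^ 2 : ℝ) : ℂ) := fun x => by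
    simp only [hX₁, hVd]
    rw [RCLike.conj_mul]
    simp
  have hIG : ∫⁻ x, ENNReal.ofReal (G x) * ‖dirDeriv d W x‖ₑ ^ 2 ∂μ =
      ‖∫ x, (G x : ℂ) * X₁ x ∂μ‖ₑ := by
    have e1 : ∀ x, (G x : ℂ) * X₁ x = ((G x * ‖dirDeriv d W x‖ ^ 2 : ℝ) : ℂ) := fun x => by
      rw [hX₁n]; push_cast; rfl
    have iG' : Integrable (fun x => G x * ‖dirDeriv d W x‖ ^ 2) μ := by
      simp only [e1] at iG
      exact iG.re
    simp only [e1]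
    rw [integral_complex_ofReal, ← ofReal_norm, Complex.norm_real, Real.norm_of_nonneg
      (integral_nonneg fun x => by have := hG x; positivity),
      ofReal_integral_eq_lintegral_ofReal iG'
        (.of_forall fun x => by have := hG x; positivity)]
    refine lintegral_congr fun x => ?_
    rw [ENNReal.ofReal_mul (hG x), ENNReal.ofReal_pow (norm_nonneg _), ofReal_norm]
  rw [hIG, show ∫ x, (G x : ℂ) * X₁ x ∂μ = ∫ x, ((G x : ℂ) * X₁ x - R x) ∂μ by
    rw [integral_sub iG iR, hR0, sub_zero]]
  refine (enorm_integral_le_lintegral_enorm _).trans (lintegral_mono fun x => ?_)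
  have hRx : (G x : ℂ) * X₁ x - R x = -((dirDeriv d' b x - G x : ℝ) * X₁ x +
      (dirDeriv τ b x : ℝ) * X₂ x + (dirDeriv d b x : ℝ) * X₃ x + (dirDeriv p b x : ℝ) * X₄ x +
      (dirDeriv q b x : ℝ) * X₅ x +
      b x * (σ * (conj (F x) * dirDeriv d W x + F x * conj (dirDeriv d W x)))) := by
    have hc : conj (F x) = -Complex.I * dirDeriv τ V x + σ * (dirDeriv d' (dirDeriv d V) x -
        dirDeriv p (dirDeriv p V) x + dirDeriv q (dirDeriv q V) x) := by
      rw [hVdd, hVdd, hVdd, hVd]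
      simp only [hF, map_add, map_mul, map_sub, hσc, Complex.conj_I]
    have hd : conj (dirDeriv d W x) = dirDeriv d V x := by rw [hVd]
    rw [hc, hd, hF x, ← id x]
    simp only [hR, hprod s₁, hprod s₂, hprod s₃, hprod s₄, hprod s₅]
    push_cast
    ring
  have hre : ∀ r : ℝ, ‖(r : ℂ)‖ₑ = ‖r‖ₑ := fun r => by
    rw [← ofReal_norm, ← ofReal_norm, Complex.norm_real]
  have hVn : ∀ e, ‖dirDeriv e V x‖ₑ = ‖dirDeriv e W x‖ₑ := fun e => by rw [hVd, enorm_conj]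
  have hVn0 : ‖V x‖ₑ = ‖W x‖ₑ := by rw [hV, enorm_conj]
  have h2I : ∀ z : ℂ, ‖z‖ₑ = 1 → ∀ A B : ℂ, ‖z / (2 * Complex.I) * (A - B)‖ₑ ≤
      2⁻¹ * (‖A‖ₑ + ‖B‖ₑ) := fun z hz A B => by
    rw [enorm_mul, div_eq_mul_inv, enorm_mul, hz, one_mul]
    refine mul_le_mul' (le_of_eq ?_) enorm_sub_le
    rw [enorm_inv (by simp), enorm_mul, hIn, mul_one]
    congr 1
    rw [← ofReal_norm]; simp
  have hhalf : ∀ a : ℝ≥0∞, 2⁻¹ * (a + a) = a := fun a => by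
    rw [← two_mul, ← mul_assoc, ENNReal.inv_mul_cancel (by simp) (by simp), one_mul]
  rw [hRx, enorm_neg]
  refine (enorm_add_le _ _).trans (add_le_add ((enorm_add_le _ _).trans (add_le_add
    ((enorm_add_le _ _).trans (add_le_add ((enorm_add_le _ _).trans (add_le_add
    ((enorm_add_le _ _).trans (add_le_add ?_ ?_)) ?_)) ?_)) ?_)) ?_)
  · rw [enorm_mul, hre, hX₁, enorm_mul, hVn, ← sq]
  · rw [enorm_mul, hre]
    refine mul_le_mul' le_rfl ((h2I _ hσn _ _).trans_eq ?_)
    rw [enorm_mul, enorm_mul, hVn, hVn0, hhalf]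
  · rw [enorm_mul, hre]
    refine mul_le_mul' le_rfl ((enorm_add_le _ _).trans (add_le_add ?_ ?_))
    · refine (h2I _ (by rw [enorm_neg, hσn]) _ _).trans_eq ?_
      rw [enorm_mul, enorm_mul, hVn, hVn0, hhalf]
    · refine enorm_sub_le.trans_eq ?_
      rw [enorm_mul, enorm_mul, hVn, hVn, sq, sq]
  · rw [enorm_mul, hre]
    refine mul_le_mul' le_rfl ?_
    rw [hX₄, enorm_mul, enorm_neg, enorm_one, one_mul]
    refine (enorm_add_le _ _).trans_eq ?_
    rw [enorm_mul, enorm_mul, hVn, hVn, two_mul]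
  · rw [enorm_mul, hre]
    refine mul_le_mul' le_rfl ?_
    refine (enorm_add_le _ _).trans_eq ?_
    rw [enorm_mul, enorm_mul, hVn, hVn, two_mul]
  · rw [enorm_mul, hre, enorm_mul, hσn, one_mul]
    refine mul_le_mul' le_rfl ?_
    refine (enorm_add_le _ _).trans_eq ?_
    rw [enorm_mul, enorm_mul, enorm_conj, enorm_conj, two_mul]

end DirDeriv

/-- The configuration space of two particles on the plane, with a common time. -/
abbrev TwoBody := ℝ × (ℝ × ℝ) × (ℝ × ℝ)

/-- The product `u(t, x) * conj v(t, y)`. -/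
def tensorConj (u v : ℝ × ℝ × ℝ → ℂ) (q : TwoBody) : ℂ :=
  u (q.1, q.2.1) * conj (v (q.1, q.2.2))

lemma contDiff_tensorConj {u v : ℝ × ℝ × ℝ → ℂ} (hu : ContDiff ℝ (⊤ : ℕ∞) u)
    (hv : ContDiff ℝ (⊤ : ℕ∞) v) : ContDiff ℝ (⊤ : ℕ∞) (tensorConj u v) := by
  refine (hu.comp (f := fun q : TwoBody => (q.1, q.2.1)) (by fun_prop)).mul
    ((Complex.conjCLE : ℂ →L[ℝ] ℂ).contDiff.comp
      (hv.comp (f := fun q : TwoBody => (q.1, q.2.2)) (by fun_prop)))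

lemma dirDeriv_comp_clm {E F : Type*} [NormedAddCommGroup E] [NormedSpace ℝ E]
    [NormedAddCommGroup F] [NormedSpace ℝ F] {f : F → ℂ} (hf : ContDiff ℝ (⊤ : ℕ∞) f)
    (L : E →L[ℝ] F) (e p : E) : dirDeriv e (fun x => f (L x)) p = dirDeriv (L e) f (L p) := by
  have := ((hf.differentiable (by simp) (L p)).hasFDerivAt.comp p L.hasFDerivAt).fderiv
  unfold dirDeriv
  rw [show (fun x => f (L x)) = f ∘ L from rfl, this]
  rfl

lemma dirDeriv_tensorConj {u v : ℝ × ℝ × ℝ → ℂ} (hu : ContDiff ℝ (⊤ : ℕ∞) u)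
    (hv : ContDiff ℝ (⊤ : ℕ∞) v) (s : ℝ) (e e' : ℝ × ℝ) :
    dirDeriv (s, e, e') (tensorConj u v) = fun q =>
      tensorConj (dirDeriv (s, e) u) v q + tensorConj u (dirDeriv (s, e') v) q := by
  funext q
  have c1 : ContDiff ℝ (⊤ : ℕ∞) fun q : TwoBody => u (q.1, q.2.1) :=
    hu.comp (f := fun q : TwoBody => (q.1, q.2.1)) (by fun_prop)
  have c2 : ContDiff ℝ (⊤ : ℕ∞) fun q : TwoBody => v (q.1, q.2.2) :=
    hv.comp (f := fun q : TwoBody => (q.1, q.2.2)) (by fun_prop)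
  have d1 : dirDeriv (s, e, e') (fun q : TwoBody => u (q.1, q.2.1)) q =
      dirDeriv (s, e) u (q.1, q.2.1) := dirDeriv_comp_clm hu
    ((ContinuousLinearMap.fst ℝ ℝ _).prod
      ((ContinuousLinearMap.fst ℝ (ℝ × ℝ) (ℝ × ℝ)).comp (ContinuousLinearMap.snd ℝ ℝ _))) _ q
  have d2 : dirDeriv (s, e, e') (fun q : TwoBody => v (q.1, q.2.2)) q =
      dirDeriv (s, e') v (q.1, q.2.2) := dirDeriv_comp_clm hv
    ((ContinuousLinearMap.fst ℝ ℝ _).prod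
      ((ContinuousLinearMap.snd ℝ (ℝ × ℝ) (ℝ × ℝ)).comp (ContinuousLinearMap.snd ℝ ℝ _))) _ q
  have c3 : ContDiff ℝ (⊤ : ℕ∞) fun q : TwoBody => conj (v (q.1, q.2.2)) :=
    (Complex.conjCLE : ℂ →L[ℝ] ℂ).contDiff.comp c2
  unfold tensorConj
  rw [dirDeriv_mul c1 c3, dirDeriv_conj c2, d1, d2]

lemma dirDeriv_zero {E : Type*} [NormedAddCommGroup E] [NormedSpace ℝ E] (f : E → ℂ) :
    dirDeriv (0 : E) f = 0 := by
  funext p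
  simp [dirDeriv]

lemma dirDeriv_neg {E : Type*} [NormedAddCommGroup E] [NormedSpace ℝ E] (e : E) (f : E → ℂ)
    (p : E) : dirDeriv (-e) f p = -dirDeriv e f p := by
  simp [dirDeriv]

lemma enorm_tensorConj (u v : ℝ × ℝ × ℝ → ℂ) (q : TwoBody) :
    ‖tensorConj u v q‖ₑ = ‖u (q.1, q.2.1)‖ₑ * ‖v (q.1, q.2.2)‖ₑ := by
  rw [tensorConj, enorm_mul, enorm_conj]

/-- A pair of orthogonal coordinate directions together with the sign with which the second
derivative in the first direction enters the hyperbolic Schrödinger operator. -/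
def IsFrame (e f : ℝ × ℝ) (σ : ℂ) : Prop :=
  (e = (1, 0) ∧ f = (0, 1) ∧ σ = 1) ∨ (e = (0, 1) ∧ f = (1, 0) ∧ σ = -1)

lemma IsFrame.hypSchrod_eq {e f : ℝ × ℝ} {σ : ℂ} (h : IsFrame e f σ) (u : ℝ × ℝ × ℝ → ℂ)
    (p : ℝ × ℝ × ℝ) : hypSchrod u p = Complex.I * dirDeriv (1, 0) u p +
      σ * (spaceDeriv e (spaceDeriv e u) p - spaceDeriv f (spaceDeriv f u) p) := by
  rcases h with ⟨rfl, rfl, rfl⟩ | ⟨rfl, rfl, rfl⟩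
  · change Complex.I * dirDeriv (1, 0) u p + spaceDeriv (1, 0) (spaceDeriv (1, 0) u) p -
      spaceDeriv (0, 1) (spaceDeriv (0, 1) u) p = _
    ring
  · change Complex.I * dirDeriv (1, 0) u p + spaceDeriv (1, 0) (spaceDeriv (1, 0) u) p -
      spaceDeriv (0, 1) (spaceDeriv (0, 1) u) p = _
    ring

lemma dirDeriv_center_tensorConj {u v : ℝ × ℝ × ℝ → ℂ} (hu : ContDiff ℝ (⊤ : ℕ∞) u)
    (hv : ContDiff ℝ (⊤ : ℕ∞) v) (e : ℝ × ℝ) : dirDeriv (0, e, e) (tensorConj u v) = fun q =>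
      tensorConj (spaceDeriv e u) v q + tensorConj u (spaceDeriv e v) q :=
  dirDeriv_tensorConj hu hv _ _ _

lemma dirDeriv_left_tensorConj {u v : ℝ × ℝ × ℝ → ℂ} (hu : ContDiff ℝ (⊤ : ℕ∞) u)
    (hv : ContDiff ℝ (⊤ : ℕ∞) v) (e : ℝ × ℝ) : dirDeriv (0, e, 0) (tensorConj u v) =
      tensorConj (spaceDeriv e u) v := by
  rw [dirDeriv_tensorConj hu hv]
  funext q
  rw [show ((0 : ℝ), (0 : ℝ × ℝ)) = 0 from rfl, dirDeriv_zero]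
  simp [tensorConj, spaceDeriv, dirDeriv]

lemma dirDeriv_right_tensorConj {u v : ℝ × ℝ × ℝ → ℂ} (hu : ContDiff ℝ (⊤ : ℕ∞) u)
    (hv : ContDiff ℝ (⊤ : ℕ∞) v) (e : ℝ × ℝ) : dirDeriv (0, 0, e) (tensorConj u v) =
      tensorConj u (spaceDeriv e v) := by
  rw [dirDeriv_tensorConj hu hv]
  funext q
  rw [show ((0 : ℝ), (0 : ℝ × ℝ)) = 0 from rfl, dirDeriv_zero]
  simp [tensorConj, spaceDeriv, dirDeriv]

lemma dirDeriv_relative_center_tensorConj {u v : ℝ × ℝ × ℝ → ℂ} (hu : ContDiff ℝ (⊤ : ℕ∞) u)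
    (hv : ContDiff ℝ (⊤ : ℕ∞) v) (e : ℝ × ℝ) (q : TwoBody) :
    dirDeriv (0, e, -e) (dirDeriv (0, e, e) (tensorConj u v)) q =
      tensorConj (spaceDeriv e (spaceDeriv e u)) v q -
        tensorConj u (spaceDeriv e (spaceDeriv e v)) q := by
  have hu' : ContDiff ℝ (⊤ : ℕ∞) (spaceDeriv e u) := hu.dirDeriv _
  have hv' : ContDiff ℝ (⊤ : ℕ∞) (spaceDeriv e v) := hv.dirDeriv _
  have hn : ∀ w : ℝ × ℝ × ℝ → ℂ, dirDeriv ((0 : ℝ), -e) w = fun p => -spaceDeriv e w p := by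
    intro w
    funext p
    rw [show ((0 : ℝ), -e) = -((0 : ℝ), e) by simp, dirDeriv_neg]
    rfl
  rw [dirDeriv_center_tensorConj hu hv, dirDeriv_add (contDiff_tensorConj hu' hv)
    (contDiff_tensorConj hu hv'), dirDeriv_tensorConj hu' hv, dirDeriv_tensorConj hu hv', hn, hn]
  simp only [tensorConj, map_neg]
  change (spaceDeriv e (spaceDeriv e u) _ * _ + _) + (spaceDeriv e u _ * _ + _) = _
  ring

lemma IsFrame.tensorConj_equation {u v : ℝ × ℝ × ℝ → ℂ} (hu : ContDiff ℝ (⊤ : ℕ∞) u)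
    (hv : ContDiff ℝ (⊤ : ℕ∞) v) {e f : ℝ × ℝ} {σ : ℂ} (h : IsFrame e f σ) (q : TwoBody) :
    tensorConj (hypSchrod u) v q - tensorConj u (hypSchrod v) q =
      Complex.I * dirDeriv (1, 0, 0) (tensorConj u v) q +
        σ * (dirDeriv (0, e, -e) (dirDeriv (0, e, e) (tensorConj u v)) q -
          dirDeriv (0, f, 0) (dirDeriv (0, f, 0) (tensorConj u v)) q +
          dirDeriv (0, 0, f) (dirDeriv (0, 0, f) (tensorConj u v)) q) := by
  have hσ : conj σ = σ := by rcases h with ⟨_, _, rfl⟩ | ⟨_, _, rfl⟩ <;> simp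
  rw [dirDeriv_relative_center_tensorConj hu hv, dirDeriv_left_tensorConj hu hv,
    dirDeriv_left_tensorConj (u := spaceDeriv f u) (hu.dirDeriv _) hv,
    dirDeriv_right_tensorConj hu hv,
    dirDeriv_right_tensorConj (v := spaceDeriv f v) hu (hv.dirDeriv _), dirDeriv_tensorConj hu hv]
  simp only [tensorConj, h.hypSchrod_eq, map_add, map_sub, map_mul, Complex.conj_I, hσ]
  ring

lemma lintegral_spaceTime {α : ℝ × ℝ × ℝ → ℝ≥0∞} (hα : Measurable α) :
    ∫⁻ p, α p = ∫⁻ t, ∫⁻ x, α (t, x) := by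
  rw [Measure.volume_eq_prod, lintegral_prod _ hα.aemeasurable]

lemma lintegral_twoBody {α β : ℝ × ℝ × ℝ → ℝ≥0∞} (hα : Measurable α) (hβ : Measurable β)
    {θ : ℝ → ℝ≥0∞} (hθ : Measurable θ) :
    ∫⁻ q : TwoBody, θ q.1 * (α (q.1, q.2.1) * β (q.1, q.2.2)) =
      ∫⁻ t, θ t * ((∫⁻ x, α (t, x)) * ∫⁻ y, β (t, y)) := by
  have h : Measurable fun q : TwoBody => θ q.1 * (α (q.1, q.2.1) * β (q.1, q.2.2)) := by fun_prop
  rw [Measure.volume_eq_prod, lintegral_prod _ h.aemeasurable]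
  refine lintegral_congr fun t => ?_
  simp only
  have h1 : Measurable fun x => α (t, x) := by fun_prop
  have h2 : Measurable fun x => β (t, x) := by fun_prop
  rw [lintegral_const_mul _ (by fun_prop), Measure.volume_eq_prod,
    lintegral_prod_mul h1.aemeasurable h2.aemeasurable]

lemma lintegral_twoBody_le_left {α β : ℝ × ℝ × ℝ → ℝ≥0∞} (hα : Measurable α) (hβ : Measurable β)
    {a b : ℝ≥0∞} (ha : ∫⁻ p, α p ≤ a) (hb : ∀ t, ∫⁻ y, β (t, y) ≤ b) :
    ∫⁻ q : TwoBody, α (q.1, q.2.1) * β (q.1, q.2.2) ≤ a * b := by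
  have h := lintegral_twoBody hα hβ (θ := 1) measurable_one
  simp only [Pi.one_apply, one_mul] at h
  rw [h]
  have h1 : Measurable fun t => ∫⁻ x, α (t, x) := hα.lintegral_prod_right'
  calc ∫⁻ t, (∫⁻ x, α (t, x)) * ∫⁻ y, β (t, y) ≤ ∫⁻ t, (∫⁻ x, α (t, x)) * b := by
        gcongr with t; exact hb t
    _ = (∫⁻ p, α p) * b := by
        rw [lintegral_mul_const _ h1, lintegral_spaceTime hα]
    _ ≤ _ := by gcongr

lemma lintegral_twoBody_le_right {α β : ℝ × ℝ × ℝ → ℝ≥0∞} (hα : Measurable α) (hβ : Measurable β)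
    {a b : ℝ≥0∞} (ha : ∀ t, ∫⁻ x, α (t, x) ≤ a) (hb : ∫⁻ p, β p ≤ b) :
    ∫⁻ q : TwoBody, α (q.1, q.2.1) * β (q.1, q.2.2) ≤ a * b := by
  have h := lintegral_twoBody hα hβ (θ := 1) measurable_one
  simp only [Pi.one_apply, one_mul] at h
  rw [h]
  have h1 : Measurable fun t => ∫⁻ x, β (t, x) := hβ.lintegral_prod_right'
  calc ∫⁻ t, (∫⁻ x, α (t, x)) * ∫⁻ y, β (t, y) ≤ ∫⁻ t, a * ∫⁻ y, β (t, y) := by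
        gcongr with t; exact ha t
    _ = a * ∫⁻ p, β p := by
        rw [lintegral_const_mul _ h1, lintegral_spaceTime hβ]
    _ ≤ _ := by gcongr

lemma lintegral_twoBody_le_time {α β : ℝ × ℝ × ℝ → ℝ≥0∞} (hα : Measurable α) (hβ : Measurable β)
    {θ : ℝ → ℝ≥0∞} (hθ : Measurable θ) {a b : ℝ≥0∞} (ha : ∀ t, ∫⁻ x, α (t, x) ≤ a)
    (hb : ∀ t, ∫⁻ y, β (t, y) ≤ b) :
    ∫⁻ q : TwoBody, θ q.1 * (α (q.1, q.2.1) * β (q.1, q.2.2)) ≤ (∫⁻ t, θ t) * (a * b) := by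
  rw [lintegral_twoBody hα hβ hθ, ← lintegral_mul_const _ hθ]
  gcongr with t
  · exact ha t
  · exact hb t

/-- A smooth bump on the time axis. -/
def timeBump : ContDiffBump (0 : ℝ) := ⟨1, 2, by norm_num, by norm_num⟩

/-- A smooth bump on the space of pairs of positions. -/
def pairBump : ContDiffBump (0 : (ℝ × ℝ) × (ℝ × ℝ)) := ⟨1, 2, by norm_num, by norm_num⟩

lemma exists_norm_fderiv_bump_le {E : Type*} [NormedAddCommGroup E] [NormedSpace ℝ E]
    [HasContDiffBump E] [FiniteDimensional ℝ E] (φ : ContDiffBump (0 : E)) :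
    ∃ M : ℝ, ∀ x, ‖fderiv ℝ φ x‖ ≤ M :=
  (φ.hasCompactSupport.fderiv (𝕜 := ℝ)).exists_bound_of_continuous
    (φ.contDiff.continuous_fderiv (n := 1) (by simp))

lemma exists_bumpBound : ∃ M : ℝ, (∀ t, ‖fderiv ℝ timeBump t‖ ≤ M) ∧
    ∀ z, ‖fderiv ℝ pairBump z‖ ≤ M := by
  obtain ⟨M₁, h₁⟩ := exists_norm_fderiv_bump_le timeBump
  obtain ⟨M₂, h₂⟩ := exists_norm_fderiv_bump_le pairBump
  exact ⟨max M₁ M₂, fun t => (h₁ t).trans (le_max_left _ _),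
    fun z => (h₂ z).trans (le_max_right _ _)⟩

/-- A bound for the first derivatives of the two bumps. -/
def bumpBound : ℝ := exists_bumpBound.choose

lemma norm_fderiv_timeBump_le (t : ℝ) : ‖fderiv ℝ timeBump t‖ ≤ bumpBound :=
  exists_bumpBound.choose_spec.1 t

lemma norm_fderiv_pairBump_le (z : (ℝ × ℝ) × (ℝ × ℝ)) : ‖fderiv ℝ pairBump z‖ ≤ bumpBound :=
  exists_bumpBound.choose_spec.2 z

lemma bumpBound_nonneg : 0 ≤ bumpBound := (norm_nonneg _).trans (norm_fderiv_timeBump_le 0)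

/-- The relative coordinate of a pair of positions in the direction `e`. -/
def relCoord (e : ℝ × ℝ) : (ℝ × ℝ) × (ℝ × ℝ) →L[ℝ] ℝ :=
  (e.1 • ContinuousLinearMap.fst ℝ ℝ ℝ + e.2 • ContinuousLinearMap.snd ℝ ℝ ℝ).comp
    (ContinuousLinearMap.fst ℝ (ℝ × ℝ) (ℝ × ℝ) - ContinuousLinearMap.snd ℝ (ℝ × ℝ) (ℝ × ℝ))

lemma relCoord_apply (e : ℝ × ℝ) (z : (ℝ × ℝ) × (ℝ × ℝ)) :
    relCoord e z = e.1 * (z.1.1 - z.2.1) + e.2 * (z.1.2 - z.2.2) := by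
  simp [relCoord]
  ring

/-- The space-time cutoff at time scale `T` and length scale `R`. -/
def cutoff (T R : ℝ) (q : TwoBody) : ℝ := timeBump (T⁻¹ * q.1) * pairBump (R⁻¹ • q.2)

/-- The localized virial weight. -/
def virialWeight (l T R : ℝ) (e : ℝ × ℝ) (q : TwoBody) : ℝ :=
  cutoff T R q * Real.arctan (l * relCoord e q.2)

/-- The density of the relative momentum in the virial estimate. -/
def virialDensity (l : ℝ) (e : ℝ × ℝ) (z : (ℝ × ℝ) × (ℝ × ℝ)) : ℝ :=
  l / (1 + (l * relCoord e z) ^ 2)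

lemma contDiff_cutoff (T R : ℝ) : ContDiff ℝ (⊤ : ℕ∞) (cutoff T R) :=
  (timeBump.contDiff.comp (f := fun q : TwoBody => T⁻¹ * q.1) (by fun_prop)).mul
    (pairBump.contDiff.comp (f := fun q : TwoBody => R⁻¹ • q.2) (by fun_prop))

lemma contDiff_virialWeight (l T R : ℝ) (e : ℝ × ℝ) :
    ContDiff ℝ (⊤ : ℕ∞) (virialWeight l T R e) :=
  (contDiff_cutoff T R).mul (Real.contDiff_arctan.comp
    (f := fun q : TwoBody => l * relCoord e q.2) (by fun_prop))

lemma cutoff_eq_zero_of_lt {T R : ℝ} (hT : 0 < T) {q : TwoBody} (hq : 2 * T < |q.1|) :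
    cutoff T R q = 0 := by
  unfold cutoff
  rw [timeBump.zero_of_le_dist, zero_mul]
  simp only [dist_zero_right, norm_mul, norm_inv, Real.norm_eq_abs, abs_of_pos hT]
  change 2 ≤ _
  rw [inv_mul_eq_div, le_div_iff₀ hT]
  exact hq.le

lemma hasCompactSupport_cutoff {T R : ℝ} (hT : 0 < T) (hR : 0 < R) :
    HasCompactSupport (cutoff T R) := by
  refine HasCompactSupport.intro (K := Metric.closedBall 0 (2 * max T R))
    (isCompact_closedBall _ _) fun q hq => ?_
  simp only [Metric.mem_closedBall, dist_zero_right, not_le] at hq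
  rcases le_total ‖q.2‖ ‖q.1‖ with h | h
  · refine cutoff_eq_zero_of_lt hT ?_
    rw [Prod.norm_def, max_eq_left h] at hq
    refine lt_of_le_of_lt ?_ hq
    have := le_max_left T R
    linarith
  · rw [Prod.norm_def, max_eq_right h] at hq
    unfold cutoff
    rw [pairBump.zero_of_le_dist, mul_zero]
    simp only [dist_zero_right, norm_smul, norm_inv, Real.norm_eq_abs, abs_of_pos hR]
    change 2 ≤ _
    rw [inv_mul_eq_div, le_div_iff₀ hR]
    have := le_max_right T R
    linarith

lemma cutoff_nonneg (T R : ℝ) (q : TwoBody) : 0 ≤ cutoff T R q :=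
  mul_nonneg timeBump.nonneg pairBump.nonneg

lemma cutoff_le_one (T R : ℝ) (q : TwoBody) : cutoff T R q ≤ 1 :=
  mul_le_one₀ timeBump.le_one pairBump.nonneg pairBump.le_one

lemma cutoff_eq_one {T R : ℝ} (hT : 0 < T) (hR : 0 < R) {q : TwoBody} (h1 : |q.1| ≤ T)
    (h2 : ‖q.2‖ ≤ R) : cutoff T R q = 1 := by
  unfold cutoff
  rw [timeBump.one_of_mem_closedBall, pairBump.one_of_mem_closedBall, one_mul]
  · simp only [Metric.mem_closedBall, dist_zero_right, norm_smul, norm_inv, Real.norm_eq_abs,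
      abs_of_pos hR]
    change _ ≤ 1
    rwa [inv_mul_eq_div, div_le_one hR]
  · simp only [Metric.mem_closedBall, dist_zero_right, norm_mul, norm_inv, Real.norm_eq_abs,
      abs_of_pos hT]
    change _ ≤ 1
    rwa [inv_mul_eq_div, div_le_one hT]

lemma abs_arctan_le_two (x : ℝ) : |Real.arctan x| ≤ 2 := by
  rw [abs_le]
  have h1 := Real.arctan_lt_pi_div_two x
  have h2 := Real.neg_pi_div_two_lt_arctan x
  have h3 := Real.pi_lt_four
  constructor <;> linarith

lemma dirDeriv_virialWeight (l T R : ℝ) (e : ℝ × ℝ) (s : ℝ) (w : (ℝ × ℝ) × (ℝ × ℝ))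
    (q : TwoBody) :
    dirDeriv (s, w) (virialWeight l T R e) q =
      (fderiv ℝ timeBump (T⁻¹ * q.1) (T⁻¹ * s) * pairBump (R⁻¹ • q.2) +
        timeBump (T⁻¹ * q.1) * fderiv ℝ pairBump (R⁻¹ • q.2) (R⁻¹ • w)) *
          Real.arctan (l * relCoord e q.2) +
      cutoff T R q * (relCoord e w * virialDensity l e q.2) := by
  have h1 : HasFDerivAt (fun q : TwoBody => T⁻¹ * q.1)
      (T⁻¹ • ContinuousLinearMap.fst ℝ ℝ ((ℝ × ℝ) × (ℝ × ℝ))) q :=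
    (T⁻¹ • ContinuousLinearMap.fst ℝ ℝ ((ℝ × ℝ) × (ℝ × ℝ))).hasFDerivAt
  have h2 : HasFDerivAt (fun q : TwoBody => R⁻¹ • q.2)
      (R⁻¹ • ContinuousLinearMap.snd ℝ ℝ ((ℝ × ℝ) × (ℝ × ℝ))) q :=
    (R⁻¹ • ContinuousLinearMap.snd ℝ ℝ ((ℝ × ℝ) × (ℝ × ℝ))).hasFDerivAt
  have h3 : HasFDerivAt (fun q : TwoBody => l * relCoord e q.2)
      (l • (relCoord e).comp (ContinuousLinearMap.snd ℝ ℝ ((ℝ × ℝ) × (ℝ × ℝ)))) q :=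
    (l • (relCoord e).comp (ContinuousLinearMap.snd ℝ ℝ ((ℝ × ℝ) × (ℝ × ℝ)))).hasFDerivAt
  have h4 := ((timeBump.contDiff (n := 1)).differentiable (by simp) (T⁻¹ * q.1)).hasFDerivAt.comp q h1
  have h5 := ((pairBump.contDiff (n := 1)).differentiable (by simp) (R⁻¹ • q.2)).hasFDerivAt.comp q h2
  have h6 := (h4.mul h5).mul h3.arctan
  have h7 : HasFDerivAt (virialWeight l T R e) _ q := h6
  unfold dirDeriv
  rw [h7.fderiv]
  simp [cutoff, virialDensity, div_eq_mul_inv]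
  ring

/-- The indicator of the time interval `[-2T, 2T]`. -/
def timeWindow (T : ℝ) : ℝ → ℝ≥0∞ := (Set.Icc (-(2 * T)) (2 * T)).indicator 1

lemma measurable_timeWindow (T : ℝ) : Measurable (timeWindow T) :=
  measurable_one.indicator measurableSet_Icc

lemma lintegral_timeWindow (T : ℝ) :
    ∫⁻ t, timeWindow T t = ENNReal.ofReal (4 * T) := by
  unfold timeWindow
  rw [lintegral_indicator_one measurableSet_Icc, Real.volume_Icc]
  congr 1
  ring

lemma enorm_le_timeWindow {T c x t : ℝ} (hc : |x| ≤ c) (h : 2 * T < |t| → x = 0) :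
    ‖x‖ₑ ≤ timeWindow T t * ENNReal.ofReal c := by
  by_cases ht : t ∈ Set.Icc (-(2 * T)) (2 * T)
  · rw [timeWindow, Set.indicator_of_mem ht, Pi.one_apply, one_mul, ← ofReal_norm]
    exact ENNReal.ofReal_le_ofReal hc
  · rw [Set.mem_Icc, ← abs_le, not_le] at ht
    simp [h ht]

lemma virialWeight_enorm_le {l T R : ℝ} (hT : 0 < T) (e : ℝ × ℝ) (q : TwoBody) :
    ‖virialWeight l T R e q‖ₑ ≤ timeWindow T q.1 * ENNReal.ofReal 2 := by
  refine enorm_le_timeWindow ?_ fun h => ?_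
  · unfold virialWeight
    rw [abs_mul, abs_of_nonneg (cutoff_nonneg T R q)]
    nlinarith [cutoff_nonneg T R q, cutoff_le_one T R q, abs_arctan_le_two (l * relCoord e q.2),
      abs_nonneg (Real.arctan (l * relCoord e q.2))]
  · rw [virialWeight, cutoff_eq_zero_of_lt hT h, zero_mul]

lemma timeBump_eq_zero_of_lt {T t : ℝ} (hT : 0 < T) (ht : 2 * T < |t|) :
    timeBump (T⁻¹ * t) = 0 := by
  rw [timeBump.zero_of_le_dist]
  simp only [dist_zero_right, norm_mul, norm_inv, Real.norm_eq_abs, abs_of_pos hT]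
  change 2 ≤ _
  rw [inv_mul_eq_div, le_div_iff₀ hT]
  exact ht.le

lemma fderiv_timeBump_eq_zero_of_lt {T t : ℝ} (hT : 0 < T) (ht : 2 * T < |t|) :
    fderiv ℝ timeBump (T⁻¹ * t) = 0 := by
  have h : T⁻¹ * t ∉ tsupport timeBump := by
    rw [timeBump.tsupport_eq, Metric.mem_closedBall, dist_zero_right, norm_mul, norm_inv,
      Real.norm_eq_abs, Real.norm_eq_abs, abs_of_pos hT, not_le]
    change 2 < _
    rwa [inv_mul_eq_div, lt_div_iff₀ hT]
  exact Function.notMem_support.1 fun h' => h (support_fderiv_subset ℝ h')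

lemma dirDeriv_time_virialWeight_enorm_le {l T R : ℝ} (hT : 0 < T) (e : ℝ × ℝ) (q : TwoBody) :
    ‖dirDeriv (1, 0, 0) (virialWeight l T R e) q‖ₑ ≤
      timeWindow T q.1 * ENNReal.ofReal (2 * bumpBound / T) := by
  rw [show ((1 : ℝ), (0 : ℝ × ℝ), (0 : ℝ × ℝ)) = (1, 0) from rfl, dirDeriv_virialWeight]
  simp only [mul_one, smul_zero, map_zero, mul_zero, zero_mul, add_zero]
  refine enorm_le_timeWindow ?_ fun h => ?_
  · rw [abs_mul, abs_mul, abs_of_nonneg pairBump.nonneg, ← Real.norm_eq_abs (fderiv _ _ _ _)]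
    have h1 : ‖fderiv ℝ timeBump (T⁻¹ * q.1) T⁻¹‖ ≤ bumpBound / T := by
      refine (ContinuousLinearMap.le_opNorm _ _).trans ?_
      rw [norm_inv, Real.norm_of_nonneg hT.le, div_eq_mul_inv]
      gcongr
      exact norm_fderiv_timeBump_le _
    have h2 := div_nonneg bumpBound_nonneg hT.le
    calc _ ≤ bumpBound / T * 1 * 2 :=
          mul_le_mul (mul_le_mul h1 pairBump.le_one pairBump.nonneg h2) (abs_arctan_le_two _)
            (abs_nonneg _) (mul_nonneg h2 zero_le_one)
      _ = _ := by ring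
  · rw [fderiv_timeBump_eq_zero_of_lt hT h]
    simp

lemma dirDeriv_space_virialWeight_enorm_le {l T R : ℝ} (hT : 0 < T) (hR : 0 < R) (e : ℝ × ℝ)
    {w : (ℝ × ℝ) × (ℝ × ℝ)} (hw : ‖w‖ ≤ 1) (q : TwoBody) :
    ‖dirDeriv (0, w) (virialWeight l T R e) q -
        cutoff T R q * (relCoord e w * virialDensity l e q.2)‖ₑ ≤
      timeWindow T q.1 * ENNReal.ofReal (2 * bumpBound / R) := by
  rw [dirDeriv_virialWeight]
  simp only [map_zero, mul_zero, zero_mul, zero_add, add_sub_cancel_right]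
  refine enorm_le_timeWindow ?_ fun h => ?_
  · rw [abs_mul, abs_mul, abs_of_nonneg timeBump.nonneg, ← Real.norm_eq_abs (fderiv _ _ _ _)]
    have h1 : ‖fderiv ℝ pairBump (R⁻¹ • q.2) (R⁻¹ • w)‖ ≤ bumpBound / R := by
      refine (ContinuousLinearMap.le_opNorm _ _).trans ?_
      rw [norm_smul, norm_inv, Real.norm_of_nonneg hR.le, div_eq_mul_inv]
      refine mul_le_mul (norm_fderiv_pairBump_le _) ?_ (by positivity) bumpBound_nonneg
      exact mul_le_of_le_one_right (by positivity) hw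
    have h2 := div_nonneg bumpBound_nonneg hR.le
    calc _ ≤ 1 * (bumpBound / R) * 2 :=
          mul_le_mul (mul_le_mul timeBump.le_one h1 (norm_nonneg _) zero_le_one)
            (abs_arctan_le_two _) (abs_nonneg _) (mul_nonneg zero_le_one h2)
      _ = _ := by ring
  · rw [timeBump_eq_zero_of_lt hT h]
    simp

lemma ENNReal_sq_add_le (a b : ℝ≥0∞) : (a + b) ^ 2 ≤ 2 * (a ^ 2 + b ^ 2) := by
  rcases eq_or_ne a ∞ with rfl | ha
  · simp
  rcases eq_or_ne b ∞ with rfl | hb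
  · simp
  lift a to ℝ≥0 using ha
  lift b to ℝ≥0 using hb
  exact_mod_cast add_sq_le (a := a) (b := b)

lemma ENNReal_le_of_sq_le_sq {a b : ℝ≥0∞} (h : a ^ 2 ≤ b ^ 2) : a ≤ b :=
  (ENNReal.pow_le_pow_left_iff two_ne_zero).1 h

lemma IsFrame.isAxis_left {e f : ℝ × ℝ} {σ : ℂ} (h : IsFrame e f σ) : IsAxis e := by
  rcases h with ⟨h, _⟩ | ⟨h, _⟩
  exacts [Or.inl h, Or.inr h]

lemma IsFrame.isAxis_right {e f : ℝ × ℝ} {σ : ℂ} (h : IsFrame e f σ) : IsAxis f := by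
  rcases h with ⟨_, h, _⟩ | ⟨_, h, _⟩
  exacts [Or.inr h, Or.inl h]

/-- The size of a function and its spatial derivatives up to second order. -/
def derivSize (e f : ℝ × ℝ) (u : ℝ × ℝ × ℝ → ℂ) (p : ℝ × ℝ × ℝ) : ℝ≥0∞ :=
  ‖u p‖ₑ + ‖spaceDeriv e u p‖ₑ + ‖spaceDeriv f u p‖ₑ + ‖spaceDeriv e (spaceDeriv e u) p‖ₑ +
    ‖spaceDeriv f (spaceDeriv f u) p‖ₑ

lemma BandLimited.measurable {l : ℝ} {u : ℝ × ℝ × ℝ → ℂ} (hu : BandLimited l u) :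
    Measurable u := hu.contDiff.continuous.measurable

lemma BandLimited.measurable_derivSize {l : ℝ} {u : ℝ × ℝ × ℝ → ℂ} (hu : BandLimited l u)
    (e f : ℝ × ℝ) : Measurable (derivSize e f u) :=
  (((hu.measurable.enorm.add (hu.spaceDeriv e).measurable.enorm).add
    (hu.spaceDeriv f).measurable.enorm).add ((hu.spaceDeriv e).spaceDeriv e).measurable.enorm).add
      ((hu.spaceDeriv f).spaceDeriv f).measurable.enorm

lemma BandLimited.massSup_spaceDeriv_ne_top {l : ℝ} {u : ℝ × ℝ × ℝ → ℂ} (hu : BandLimited l u)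
    (hl : 0 < l) {e : ℝ × ℝ} (he : IsAxis e) (hA : massSup u ≠ ∞) :
    massSup (_root_.spaceDeriv e u) ≠ ∞ :=
  ne_top_of_le_ne_top (ENNReal.mul_ne_top
    (ENNReal.pow_ne_top (ENNReal.mul_ne_top ENNReal.ofReal_ne_top kernelMass_ne_top)) hA)
    (hu.massSup_spaceDeriv_le hl he)

lemma BandLimited.exists_lintegral_derivSize_le {l : ℝ} {u : ℝ × ℝ × ℝ → ℂ}
    (hu : BandLimited l u) (hl : 0 < l) {e f : ℝ × ℝ} (he : IsAxis e) (hf : IsAxis f)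
    (hA : massSup u ≠ ∞) :
    ∃ S : ℝ≥0∞, S ≠ ∞ ∧ ∀ t, ∫⁻ x : ℝ × ℝ, derivSize e f u (t, x) ^ 2 ≤ S := by
  have key : ∀ {a b : ℝ × ℝ × ℝ → ℝ≥0∞}, Measurable a → Measurable b →
      (∃ S : ℝ≥0∞, S ≠ ∞ ∧ ∀ t, ∫⁻ x : ℝ × ℝ, a (t, x) ^ 2 ≤ S) →
      (∃ S : ℝ≥0∞, S ≠ ∞ ∧ ∀ t, ∫⁻ x : ℝ × ℝ, b (t, x) ^ 2 ≤ S) →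
      ∃ S : ℝ≥0∞, S ≠ ∞ ∧ ∀ t, ∫⁻ x : ℝ × ℝ, (a (t, x) + b (t, x)) ^ 2 ≤ S := by
    rintro a b ha hb ⟨S, hS, h⟩ ⟨S', hS', h'⟩
    refine ⟨2 * (S + S'), by finiteness, fun t => ?_⟩
    refine (lintegral_mono fun x => ENNReal_sq_add_le _ _).trans ?_
    have ha' : Measurable fun x : ℝ × ℝ => a (t, x) ^ 2 := by fun_prop
    rw [lintegral_const_mul' _ _ (by simp), lintegral_add_left ha']
    gcongr
    exacts [h t, h' t]
  have base : ∀ {w : ℝ × ℝ × ℝ → ℂ}, massSup w ≠ ∞ →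
      ∃ S : ℝ≥0∞, S ≠ ∞ ∧ ∀ t, ∫⁻ x : ℝ × ℝ, ‖w (t, x)‖ₑ ^ 2 ≤ S := fun {w} hw =>
    ⟨massSup w, hw, lintegral_le_massSup w⟩
  have he' := hu.massSup_spaceDeriv_ne_top hl he hA
  have hf' := hu.massSup_spaceDeriv_ne_top hl hf hA
  have m0 := hu.measurable.enorm
  have me := (hu.spaceDeriv e).measurable.enorm
  have mf := (hu.spaceDeriv f).measurable.enorm
  have mee := ((hu.spaceDeriv e).spaceDeriv e).measurable.enorm
  have mff := ((hu.spaceDeriv f).spaceDeriv f).measurable.enorm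
  exact key (((m0.add me).add mf).add mee) mff
    (key ((m0.add me).add mf) mee (key (m0.add me) mf (key m0 me (base hA) (base he')) (base hf'))
      (base ((hu.spaceDeriv e).massSup_spaceDeriv_ne_top hl he he')))
    (base ((hu.spaceDeriv f).massSup_spaceDeriv_ne_top hl hf hf'))

lemma BandLimited.lintegral_mul_spaceDeriv_le {l : ℝ} {u : ℝ × ℝ × ℝ → ℂ}
    (hu : BandLimited l u) (hl : 0 < l) {e : ℝ × ℝ} (he : IsAxis e) (t : ℝ) :
    ∫⁻ x : ℝ × ℝ, ‖u (t, x)‖ₑ * ‖_root_.spaceDeriv e u (t, x)‖ₑ ≤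
      ENNReal.ofReal l * kernelMass * massSup u := by
  refine ENNReal_le_of_sq_le_sq ?_
  have m0 := hu.measurable
  have me := (hu.spaceDeriv e).measurable
  refine (sq_lintegral_mul_le (f := fun x : ℝ × ℝ => ‖u (t, x)‖ₑ)
    (g := fun x : ℝ × ℝ => ‖_root_.spaceDeriv e u (t, x)‖ₑ) (by fun_prop) (by fun_prop)).trans ?_
  calc _ ≤ massSup u * ((ENNReal.ofReal l * kernelMass) ^ 2 * massSup u) :=
        mul_le_mul' (lintegral_le_massSup u t)
          ((lintegral_le_massSup _ t).trans (hu.massSup_spaceDeriv_le hl he))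
    _ = _ := by ring

lemma lintegral_mul_le_interact (u N : ℝ × ℝ × ℝ → ℂ) :
    ∫⁻ p : ℝ × ℝ × ℝ, ‖u p‖ₑ * ‖N p‖ₑ ≤ interact u N := by
  simpa using lintegral_le_interact u N 0

lemma ContDiff.hypSchrod {u : ℝ × ℝ × ℝ → ℂ} (hu : ContDiff ℝ (⊤ : ℕ∞) u) :
    ContDiff ℝ (⊤ : ℕ∞) (hypSchrod u) :=
  ((contDiff_const.mul (hu.dirDeriv _)).add ((hu.dirDeriv _).dirDeriv _)).sub
    ((hu.dirDeriv _).dirDeriv _)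

lemma enorm_dirDeriv_center_tensorConj_le {u v : ℝ × ℝ × ℝ → ℂ} (hu : ContDiff ℝ (⊤ : ℕ∞) u)
    (hv : ContDiff ℝ (⊤ : ℕ∞) v) (e : ℝ × ℝ) (q : TwoBody) :
    ‖dirDeriv (0, e, e) (tensorConj u v) q‖ₑ ≤
      ‖spaceDeriv e u (q.1, q.2.1)‖ₑ * ‖v (q.1, q.2.2)‖ₑ +
        ‖u (q.1, q.2.1)‖ₑ * ‖spaceDeriv e v (q.1, q.2.2)‖ₑ := by
  rw [dirDeriv_center_tensorConj hu hv]
  refine (enorm_add_le _ _).trans ?_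
  rw [enorm_tensorConj, enorm_tensorConj]

/-- The forcing term of the equation satisfied by a two-body tensor product. -/
def tensorForce (u v : ℝ × ℝ × ℝ → ℂ) (q : TwoBody) : ℂ :=
  tensorConj (hypSchrod u) v q - tensorConj u (hypSchrod v) q

lemma enorm_tensorForce_le (u v : ℝ × ℝ × ℝ → ℂ) (q : TwoBody) :
    ‖tensorForce u v q‖ₑ ≤ ‖hypSchrod u (q.1, q.2.1)‖ₑ * ‖v (q.1, q.2.2)‖ₑ +
        ‖u (q.1, q.2.1)‖ₑ * ‖hypSchrod v (q.1, q.2.2)‖ₑ := by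
  refine enorm_sub_le.trans ?_
  rw [enorm_tensorConj, enorm_tensorConj]

section Estimates

variable {l₁ l₂ : ℝ} {u v : ℝ × ℝ × ℝ → ℂ}

lemma lintegral_tensorForce_mul_tensorConj_le (hu : BandLimited l₁ u) (hv : BandLimited l₂ v) :
    ∫⁻ q, ‖tensorForce u v q‖ₑ * ‖tensorConj u v q‖ₑ ≤
      interact u (hypSchrod u) * massSup v + massSup u * interact v (hypSchrod v) := by
  have mu := hu.measurable
  have mv := hv.measurable
  have mNu := hu.contDiff.hypSchrod.continuous.measurable
  have mNv := hv.contDiff.hypSchrod.continuous.measurable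
  calc _ ≤ ∫⁻ q : TwoBody,
        ((‖u (q.1, q.2.1)‖ₑ * ‖hypSchrod u (q.1, q.2.1)‖ₑ) * ‖v (q.1, q.2.2)‖ₑ ^ 2 +
        ‖u (q.1, q.2.1)‖ₑ ^ 2 * (‖v (q.1, q.2.2)‖ₑ * ‖hypSchrod v (q.1, q.2.2)‖ₑ)) := by
        refine lintegral_mono fun q => (mul_le_mul' (enorm_tensorForce_le u v q)
          (enorm_tensorConj u v q).le).trans_eq ?_
        ring
    _ ≤ _ := by
        rw [lintegral_add_left (by fun_prop)]
        exact add_le_add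
          (lintegral_twoBody_le_left (α := fun p => ‖u p‖ₑ * ‖hypSchrod u p‖ₑ)
            (β := fun p => ‖v p‖ₑ ^ 2) (by fun_prop) (by fun_prop)
            (lintegral_mul_le_interact u _) (lintegral_le_massSup v))
          (lintegral_twoBody_le_right (α := fun p => ‖u p‖ₑ ^ 2)
            (β := fun p => ‖v p‖ₑ * ‖hypSchrod v p‖ₑ) (by fun_prop) (by fun_prop)
            (lintegral_le_massSup u) (lintegral_mul_le_interact v _))

lemma lintegral_tensorForce_mul_dirDeriv_le (hu : BandLimited l₁ u) (hv : BandLimited l₂ v)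
    (hl₁ : 0 < l₁) (hl₂ : 0 < l₂) {e : ℝ × ℝ} (he : IsAxis e) :
    ∫⁻ q, ‖tensorForce u v q‖ₑ * ‖dirDeriv (0, e, e) (tensorConj u v) q‖ₑ ≤
      kernelMass * ENNReal.ofReal (l₁ + l₂) *
        (interact u (hypSchrod u) * massSup v + massSup u * interact v (hypSchrod v)) := by
  have mu := hu.measurable
  have mv := hv.measurable
  have mue := (hu.spaceDeriv e).measurable
  have mve := (hv.spaceDeriv e).measurable
  have cNu := hu.contDiff.hypSchrod.continuous
  have cNv := hv.contDiff.hypSchrod.continuous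
  have mNu := cNu.measurable
  have mNv := cNv.measurable
  calc _ ≤ ∫⁻ q : TwoBody,
        ((‖spaceDeriv e u (q.1, q.2.1)‖ₑ * ‖hypSchrod u (q.1, q.2.1)‖ₑ) *
            ‖v (q.1, q.2.2)‖ₑ ^ 2 +
        ((‖u (q.1, q.2.1)‖ₑ * ‖hypSchrod u (q.1, q.2.1)‖ₑ) *
            (‖v (q.1, q.2.2)‖ₑ * ‖spaceDeriv e v (q.1, q.2.2)‖ₑ) +
        ((‖u (q.1, q.2.1)‖ₑ * ‖spaceDeriv e u (q.1, q.2.1)‖ₑ) *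
            (‖v (q.1, q.2.2)‖ₑ * ‖hypSchrod v (q.1, q.2.2)‖ₑ) +
        ‖u (q.1, q.2.1)‖ₑ ^ 2 *
            (‖spaceDeriv e v (q.1, q.2.2)‖ₑ * ‖hypSchrod v (q.1, q.2.2)‖ₑ)))) := by
        refine lintegral_mono fun q => (mul_le_mul' (enorm_tensorForce_le u v q)
          (enorm_dirDeriv_center_tensorConj_le hu.contDiff hv.contDiff e q)).trans_eq ?_
        ring
    _ ≤ (ENNReal.ofReal l₁ * kernelMass * interact u (hypSchrod u)) * massSup v +
        (interact u (hypSchrod u) * (ENNReal.ofReal l₂ * kernelMass * massSup v) +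
        ((ENNReal.ofReal l₁ * kernelMass * massSup u) * interact v (hypSchrod v) +
        massSup u * (ENNReal.ofReal l₂ * kernelMass * interact v (hypSchrod v)))) := by
        rw [lintegral_add_left (by fun_prop), lintegral_add_left (by fun_prop),
          lintegral_add_left (by fun_prop)]
        refine add_le_add ?_ (add_le_add ?_ (add_le_add ?_ ?_))
        · exact lintegral_twoBody_le_left (α := fun p => ‖spaceDeriv e u p‖ₑ * ‖hypSchrod u p‖ₑ)
            (β := fun p => ‖v p‖ₑ ^ 2) (by fun_prop) (by fun_prop)
            ((lintegral_mul_le_interact _ _).trans (hu.interact_spaceDeriv_le hl₁ he cNu))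
            (lintegral_le_massSup v)
        · exact lintegral_twoBody_le_left (α := fun p => ‖u p‖ₑ * ‖hypSchrod u p‖ₑ)
            (β := fun p => ‖v p‖ₑ * ‖spaceDeriv e v p‖ₑ) (by fun_prop) (by fun_prop)
            (lintegral_mul_le_interact _ _) (hv.lintegral_mul_spaceDeriv_le hl₂ he)
        · exact lintegral_twoBody_le_right (α := fun p => ‖u p‖ₑ * ‖spaceDeriv e u p‖ₑ)
            (β := fun p => ‖v p‖ₑ * ‖hypSchrod v p‖ₑ) (by fun_prop) (by fun_prop)
            (hu.lintegral_mul_spaceDeriv_le hl₁ he) (lintegral_mul_le_interact _ _)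
        · exact lintegral_twoBody_le_right (α := fun p => ‖u p‖ₑ ^ 2)
            (β := fun p => ‖spaceDeriv e v p‖ₑ * ‖hypSchrod v p‖ₑ) (by fun_prop) (by fun_prop)
            (lintegral_le_massSup u)
            ((lintegral_mul_le_interact _ _).trans (hv.interact_spaceDeriv_le hl₂ he cNv))
    _ = _ := by rw [ENNReal.ofReal_add hl₁.le hl₂.le]; ring

lemma lintegral_timeWindow_mul_dirDeriv_le (hu : BandLimited l₁ u) (hv : BandLimited l₂ v)
    (hl₁ : 0 < l₁) (hl₂ : 0 < l₂) {e : ℝ × ℝ} (he : IsAxis e) (T : ℝ) :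
    ∫⁻ q, timeWindow T q.1 *
        (‖tensorConj u v q‖ₑ * ‖dirDeriv (0, e, e) (tensorConj u v) q‖ₑ) ≤
      ENNReal.ofReal (4 * T) *
        (kernelMass * ENNReal.ofReal (l₁ + l₂) * (massSup u * massSup v)) := by
  have mu := hu.measurable
  have mv := hv.measurable
  have mue := (hu.spaceDeriv e).measurable
  have mve := (hv.spaceDeriv e).measurable
  have mT := measurable_timeWindow T
  calc _ ≤ ∫⁻ q : TwoBody, (timeWindow T q.1 *
        ((‖u (q.1, q.2.1)‖ₑ * ‖spaceDeriv e u (q.1, q.2.1)‖ₑ) * ‖v (q.1, q.2.2)‖ₑ ^ 2) +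
        timeWindow T q.1 * (‖u (q.1, q.2.1)‖ₑ ^ 2 *
          (‖v (q.1, q.2.2)‖ₑ * ‖spaceDeriv e v (q.1, q.2.2)‖ₑ))) := by
        refine lintegral_mono fun q => (mul_le_mul' le_rfl (mul_le_mul'
          (enorm_tensorConj u v q).le
          (enorm_dirDeriv_center_tensorConj_le hu.contDiff hv.contDiff e q))).trans_eq ?_
        ring
    _ ≤ ENNReal.ofReal (4 * T) * ((ENNReal.ofReal l₁ * kernelMass * massSup u) * massSup v) +
        ENNReal.ofReal (4 * T) * (massSup u * (ENNReal.ofReal l₂ * kernelMass * massSup v)) := by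
        rw [lintegral_add_left (by fun_prop), ← lintegral_timeWindow T]
        exact add_le_add
          (lintegral_twoBody_le_time (α := fun p => ‖u p‖ₑ * ‖spaceDeriv e u p‖ₑ)
            (β := fun p => ‖v p‖ₑ ^ 2) (by fun_prop) (by fun_prop) mT
            (hu.lintegral_mul_spaceDeriv_le hl₁ he) (lintegral_le_massSup v))
          (lintegral_twoBody_le_time (α := fun p => ‖u p‖ₑ ^ 2)
            (β := fun p => ‖v p‖ₑ * ‖spaceDeriv e v p‖ₑ) (by fun_prop) (by fun_prop) mT
            (lintegral_le_massSup u) (hv.lintegral_mul_spaceDeriv_le hl₂ he))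
    _ = _ := by rw [ENNReal.ofReal_add hl₁.le hl₂.le]; ring

end Estimates

/-- The product of the sizes of the two factors of a two-body tensor product. -/
def tensorSize (e f : ℝ × ℝ) (u v : ℝ × ℝ × ℝ → ℂ) (q : TwoBody) : ℝ≥0∞ :=
  derivSize e f u (q.1, q.2.1) * derivSize e f v (q.1, q.2.2)

section Pointwise

variable {e f : ℝ × ℝ} {u v : ℝ × ℝ × ℝ → ℂ}

lemma enorm_le_derivSize (p : ℝ × ℝ × ℝ) : ‖u p‖ₑ ≤ derivSize e f u p := by
  unfold derivSize
  simp only [add_assoc]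
  exact le_self_add

lemma enorm_fst_le_derivSize (p : ℝ × ℝ × ℝ) : ‖spaceDeriv e u p‖ₑ ≤ derivSize e f u p := by
  unfold derivSize
  simp only [add_assoc]
  exact le_add_left le_self_add

lemma enorm_snd_le_derivSize (p : ℝ × ℝ × ℝ) : ‖spaceDeriv f u p‖ₑ ≤ derivSize e f u p := by
  unfold derivSize
  simp only [add_assoc]
  exact le_add_left (le_add_left le_self_add)

lemma enorm_fst_fst_le_derivSize (p : ℝ × ℝ × ℝ) :
    ‖spaceDeriv e (spaceDeriv e u) p‖ₑ ≤ derivSize e f u p := by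
  unfold derivSize
  simp only [add_assoc]
  exact le_add_left (le_add_left (le_add_left le_self_add))

lemma enorm_snd_snd_le_derivSize (p : ℝ × ℝ × ℝ) :
    ‖spaceDeriv f (spaceDeriv f u) p‖ₑ ≤ derivSize e f u p := by
  unfold derivSize
  simp only [add_assoc]
  exact le_add_left (le_add_left (le_add_left le_add_self))

lemma enorm_tensorConj_le_size {a b : ℝ × ℝ × ℝ → ℂ} {q : TwoBody}
    (ha : ‖a (q.1, q.2.1)‖ₑ ≤ derivSize e f u (q.1, q.2.1))
    (hb : ‖b (q.1, q.2.2)‖ₑ ≤ derivSize e f v (q.1, q.2.2)) :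
    ‖tensorConj a b q‖ₑ ≤ tensorSize e f u v q := by
  rw [enorm_tensorConj]
  exact mul_le_mul' ha hb

lemma enorm_dirDeriv_center_le_size (hu : ContDiff ℝ (⊤ : ℕ∞) u) (hv : ContDiff ℝ (⊤ : ℕ∞) v)
    (q : TwoBody) :
    ‖dirDeriv (0, e, e) (tensorConj u v) q‖ₑ ≤ 2 * tensorSize e f u v q := by
  rw [dirDeriv_center_tensorConj hu hv, two_mul]
  exact (enorm_add_le _ _).trans (add_le_add
    (enorm_tensorConj_le_size (enorm_fst_le_derivSize _) (enorm_le_derivSize _))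
    (enorm_tensorConj_le_size (enorm_le_derivSize _) (enorm_fst_le_derivSize _)))

lemma enorm_dirDeriv_time_le_size (hu : ContDiff ℝ (⊤ : ℕ∞) u) (hv : ContDiff ℝ (⊤ : ℕ∞) v)
    {σ : ℂ} (h : IsFrame e f σ) (q : TwoBody) :
    ‖dirDeriv (1, 0, 0) (tensorConj u v) q‖ₑ ≤
      ‖tensorForce u v q‖ₑ + 4 * tensorSize e f u v q := by
  have hσ : ‖σ‖ₑ = 1 := by rcases h with ⟨_, _, rfl⟩ | ⟨_, _, rfl⟩ <;> simp
  have hI : ‖Complex.I‖ₑ = 1 := by rw [← ofReal_norm]; simp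
  have h1 := h.tensorConj_equation hu hv q
  rw [dirDeriv_relative_center_tensorConj hu hv, dirDeriv_left_tensorConj hu hv,
    dirDeriv_left_tensorConj (u := spaceDeriv f u) (hu.dirDeriv _) hv,
    dirDeriv_right_tensorConj hu hv,
    dirDeriv_right_tensorConj (v := spaceDeriv f v) hu (hv.dirDeriv _)] at h1
  have h2 : ‖dirDeriv (1, 0, 0) (tensorConj u v) q‖ₑ =
      ‖Complex.I * dirDeriv (1, 0, 0) (tensorConj u v) q‖ₑ := by rw [enorm_mul, hI, one_mul]
  rw [h2, ← sub_eq_iff_eq_add.2 h1]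
  refine enorm_sub_le.trans (add_le_add le_rfl ?_)
  rw [enorm_mul, hσ, one_mul]
  have e1 : ‖tensorConj (spaceDeriv e (spaceDeriv e u)) v q‖ₑ ≤ tensorSize e f u v q :=
    enorm_tensorConj_le_size (enorm_fst_fst_le_derivSize _) (enorm_le_derivSize _)
  have e2 : ‖tensorConj u (spaceDeriv e (spaceDeriv e v)) q‖ₑ ≤ tensorSize e f u v q :=
    enorm_tensorConj_le_size (enorm_le_derivSize _) (enorm_fst_fst_le_derivSize _)
  have e3 : ‖tensorConj (spaceDeriv f (spaceDeriv f u)) v q‖ₑ ≤ tensorSize e f u v q :=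
    enorm_tensorConj_le_size (enorm_snd_snd_le_derivSize _) (enorm_le_derivSize _)
  have e4 : ‖tensorConj u (spaceDeriv f (spaceDeriv f v)) q‖ₑ ≤ tensorSize e f u v q :=
    enorm_tensorConj_le_size (enorm_le_derivSize _) (enorm_snd_snd_le_derivSize _)
  calc _ ≤ tensorSize e f u v q + tensorSize e f u v q + tensorSize e f u v q +
        tensorSize e f u v q :=
        (enorm_add_le _ _).trans (add_le_add (enorm_sub_le.trans (add_le_add
          (enorm_sub_le.trans (add_le_add e1 e2)) e3)) e4)
    _ = _ := by ring

end Pointwise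

lemma virial_integrand_le {J c c₁ w d τ P Q F Z β₁ β₂ β₃ β₄ β₅ β₆ : ℝ≥0∞} (hJ : J ≤ 1)
    (hw : w ≤ Z) (hd : d ≤ 2 * Z) (hP : P ≤ Z) (hQ : Q ≤ Z) (hτ : τ ≤ F + 4 * Z)
    (h₁ : β₁ ≤ J * c) (h₂ : β₂ ≤ J * c₁) (h₃ : β₃ ≤ J * c) (h₄ : β₄ ≤ J * c) (h₅ : β₅ ≤ J * c)
    (h₆ : β₆ ≤ J * 2) :
    β₁ * d ^ 2 + β₂ * (w * d) + β₃ * (w * τ + (P ^ 2 + Q ^ 2)) + β₄ * (2 * (P * d)) +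
        β₅ * (2 * (Q * d)) + β₆ * (2 * (F * d)) ≤
      18 * c * (J * Z ^ 2) + c₁ * (J * (w * d)) + c * (F * w) + 4 * (F * d) := by
  calc _ ≤ (J * c) * (2 * Z) ^ 2 + (J * c₁) * (w * d) +
        (J * c * (w * F) + J * c * (Z * (4 * Z) + (Z ^ 2 + Z ^ 2))) +
        J * c * (2 * (Z * (2 * Z))) + J * c * (2 * (Z * (2 * Z))) + (J * 2) * (2 * (F * d)) := by
        have h : w * τ + (P ^ 2 + Q ^ 2) ≤ w * F + (Z * (4 * Z) + (Z ^ 2 + Z ^ 2)) := by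
          rw [← add_assoc (w * F)]
          refine add_le_add ?_ (by gcongr)
          calc w * τ ≤ w * (F + 4 * Z) := by gcongr
            _ ≤ _ := by rw [mul_add]; gcongr
        rw [← mul_add (J * c)]
        gcongr
    _ = 18 * c * (J * Z ^ 2) + c₁ * (J * (w * d)) + J * (c * (F * w)) + J * (4 * (F * d)) := by
        ring
    _ ≤ _ := by
        exact add_le_add (add_le_add le_rfl (mul_le_of_le_one_left' hJ))
          (mul_le_of_le_one_left' hJ)

lemma continuous_virialDensity (l : ℝ) (e : ℝ × ℝ) : Continuous (virialDensity l e) := by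
  unfold virialDensity
  exact continuous_const.div (by fun_prop) fun z => by positivity

lemma virialDensity_nonneg {l : ℝ} (hl : 0 ≤ l) (e : ℝ × ℝ) (z : (ℝ × ℝ) × (ℝ × ℝ)) :
    0 ≤ virialDensity l e z := by
  unfold virialDensity
  positivity

lemma IsAxis.norm_eq_one {e : ℝ × ℝ} (he : IsAxis e) : ‖e‖ = 1 := by
  rcases he with rfl | rfl <;> simp [Prod.norm_def]

lemma isAddHaarMeasure_prod {E F : Type*} [NormedAddCommGroup E] [NormedSpace ℝ E]
    [MeasureSpace E] [BorelSpace E] [SecondCountableTopology E] [NormedAddCommGroup F]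
    [NormedSpace ℝ F] [MeasureSpace F] [BorelSpace F] [SecondCountableTopology F]
    [SFinite (volume : Measure E)] [SFinite (volume : Measure F)]
    (hE : (volume : Measure E).IsAddHaarMeasure) (hF : (volume : Measure F).IsAddHaarMeasure) :
    (volume : Measure (E × F)).IsAddHaarMeasure := by
  rw [Measure.volume_eq_prod]
  infer_instance

instance : (volume : Measure TwoBody).IsAddHaarMeasure :=
  isAddHaarMeasure_prod inferInstance
    (isAddHaarMeasure_prod (isAddHaarMeasure_prod inferInstance inferInstance)
      (isAddHaarMeasure_prod inferInstance inferInstance))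

section Estimates

variable {l₁ l₂ : ℝ} {u v : ℝ × ℝ × ℝ → ℂ} {e f : ℝ × ℝ} {σ : ℂ}

lemma lintegral_cutoff_virialDensity_le (hu : ContDiff ℝ (⊤ : ℕ∞) u)
    (hv : ContDiff ℝ (⊤ : ℕ∞) v) (hl₂ : 0 < l₂) (h : IsFrame e f σ) {T : ℝ} (hT : 1 ≤ T) :
    ∫⁻ q : TwoBody, ENNReal.ofReal (cutoff T (T ^ 2) q * (2 * virialDensity l₂ e q.2)) *
        ‖dirDeriv (0, e, e) (tensorConj u v) q‖ₑ ^ 2 ≤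
      ∫⁻ q : TwoBody, (18 * ENNReal.ofReal (2 * bumpBound / T ^ 2) *
          (timeWindow T q.1 * tensorSize e f u v q ^ 2) +
        ENNReal.ofReal (2 * bumpBound / T) * (timeWindow T q.1 *
          (‖tensorConj u v q‖ₑ * ‖dirDeriv (0, e, e) (tensorConj u v) q‖ₑ)) +
        ENNReal.ofReal (2 * bumpBound / T ^ 2) *
          (‖tensorForce u v q‖ₑ * ‖tensorConj u v q‖ₑ) +
        4 * (‖tensorForce u v q‖ₑ * ‖dirDeriv (0, e, e) (tensorConj u v) q‖ₑ)) := by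
  have hT0 : 0 < T := by linarith
  have hR0 : 0 < T ^ 2 := by positivity
  have hσ : σ = 1 ∨ σ = -1 := by
    rcases h with ⟨_, _, h⟩ | ⟨_, _, h⟩
    exacts [Or.inl h, Or.inr h]
  have hcs := hasCompactSupport_cutoff hT0 hR0
  refine (bilinear_virial_le (volume : Measure TwoBody) (b := virialWeight l₂ T (T ^ 2) e)
    (F := tensorForce u v)
    (G := fun q : TwoBody => cutoff T (T ^ 2) q * (2 * virialDensity l₂ e q.2))
    (contDiff_tensorConj hu hv) (contDiff_virialWeight l₂ T (T ^ 2) e) hcs.mul_right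
    (fun q => mul_nonneg (cutoff_nonneg _ _ _)
      (mul_nonneg zero_le_two (virialDensity_nonneg hl₂.le _ _)))
    ((contDiff_cutoff T (T ^ 2)).continuous.mul
      (continuous_const.mul ((continuous_virialDensity l₂ e).comp continuous_snd)))
    hcs.mul_right hσ (1, 0, 0) (0, e, e) (0, e, -e) (0, f, 0) (0, 0, f)
    (h.tensorConj_equation hu hv)).trans (lintegral_mono fun q => ?_)
  have hJ : timeWindow T q.1 ≤ 1 := Set.indicator_le_self _ _ _
  have ne := h.isAxis_left.norm_eq_one
  have nf := h.isAxis_right.norm_eq_one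
  have r1 : relCoord e (e, -e) = 2 := by
    rw [relCoord_apply]; rcases h with ⟨rfl, _⟩ | ⟨rfl, _⟩ <;> norm_num
  have r2 : relCoord e (e, e) = 0 := by
    rw [relCoord_apply]; ring
  have r3 : relCoord e (f, 0) = 0 := by
    rw [relCoord_apply]; rcases h with ⟨rfl, rfl, _⟩ | ⟨rfl, rfl, _⟩ <;> norm_num
  have r4 : relCoord e (0, f) = 0 := by
    rw [relCoord_apply]; rcases h with ⟨rfl, rfl, _⟩ | ⟨rfl, rfl, _⟩ <;> norm_num
  have b1 := dirDeriv_space_virialWeight_enorm_le (l := l₂) hT0 hR0 e (w := (e, -e))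
    (by simp [Prod.norm_def (e, -e), ne]) q
  have b2 := dirDeriv_space_virialWeight_enorm_le (l := l₂) hT0 hR0 e (w := (e, e))
    (by simp [Prod.norm_def (e, e), ne]) q
  have b3 := dirDeriv_space_virialWeight_enorm_le (l := l₂) hT0 hR0 e (w := (f, 0))
    (by simp [Prod.norm_def (f, (0 : ℝ × ℝ)), nf]) q
  have b4 := dirDeriv_space_virialWeight_enorm_le (l := l₂) hT0 hR0 e (w := (0, f))
    (by simp [Prod.norm_def ((0 : ℝ × ℝ), f), nf]) q
  rw [r1] at b1
  rw [r2, zero_mul, mul_zero, sub_zero] at b2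
  rw [r3, zero_mul, mul_zero, sub_zero] at b3
  rw [r4, zero_mul, mul_zero, sub_zero] at b4
  refine virial_integrand_le (Z := tensorSize e f u v q) hJ
    (enorm_tensorConj_le_size (enorm_le_derivSize _) (enorm_le_derivSize _))
    (enorm_dirDeriv_center_le_size hu hv q) ?_ ?_ (enorm_dirDeriv_time_le_size hu hv h q)
    b1 (dirDeriv_time_virialWeight_enorm_le hT0 e q) b2 b3 b4
    ((virialWeight_enorm_le hT0 e q).trans_eq (by norm_num))
  · rw [dirDeriv_left_tensorConj hu hv]
    exact enorm_tensorConj_le_size (enorm_snd_le_derivSize _) (enorm_le_derivSize _)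
  · rw [dirDeriv_right_tensorConj hu hv]
    exact enorm_tensorConj_le_size (enorm_le_derivSize _) (enorm_snd_le_derivSize _)

lemma measurable_dirDeriv_tensorConj (hu : ContDiff ℝ (⊤ : ℕ∞) u)
    (hv : ContDiff ℝ (⊤ : ℕ∞) v) (d : TwoBody) : Measurable (dirDeriv d (tensorConj u v)) :=
  ((contDiff_tensorConj hu hv).dirDeriv d).continuous.measurable

lemma measurable_tensorForce (hu : ContDiff ℝ (⊤ : ℕ∞) u)
    (hv : ContDiff ℝ (⊤ : ℕ∞) v) : Measurable (tensorForce u v) :=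
  ((contDiff_tensorConj hu.hypSchrod hv).sub
    (contDiff_tensorConj hu hv.hypSchrod)).continuous.measurable

/-- The bilinear energy attached to a pair of solutions. -/
def bilinearEnergy (u v : ℝ × ℝ × ℝ → ℂ) : ℝ≥0∞ :=
  massSup u * massSup v + (interact u (hypSchrod u) * massSup v +
    massSup u * interact v (hypSchrod v))

/-- The constant in the virial estimate. -/
def virialConst : ℝ≥0∞ := (ENNReal.ofReal (8 * bumpBound) + 4) * kernelMass

lemma virialConst_ne_top : virialConst ≠ ∞ :=
  ENNReal.mul_ne_top (by finiteness) kernelMass_ne_top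

lemma lintegral_virialDensity_le (hu : BandLimited l₁ u) (hv : BandLimited l₂ v)
    (hl₁ : 0 < l₁) (hl₂ : 0 < l₂) (h : IsFrame e f σ) (hA : massSup u ≠ ∞) (hB : massSup v ≠ ∞)
    (hI : interact u (hypSchrod u) ≠ ∞) (hI' : interact v (hypSchrod v) ≠ ∞) :
    ∫⁻ q : TwoBody, ENNReal.ofReal (virialDensity l₂ e q.2) *
        ‖dirDeriv (0, e, e) (tensorConj u v) q‖ₑ ^ 2 ≤
      virialConst * ENNReal.ofReal (l₁ + l₂) * bilinearEnergy u v := by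
  have he := h.isAxis_left
  have hf := h.isAxis_right
  obtain ⟨S, hS, hSu⟩ := hu.exists_lintegral_derivSize_le hl₁ he hf hA
  obtain ⟨S', hS', hSv⟩ := hv.exists_lintegral_derivSize_le hl₂ he hf hB
  set Q := interact u (hypSchrod u) * massSup v + massSup u * interact v (hypSchrod v) with hQ
  set L := kernelMass * ENNReal.ofReal (l₁ + l₂) with hL
  have hQt : Q ≠ ∞ := by finiteness
  have mW := measurable_dirDeriv_tensorConj hu.contDiff hv.contDiff (0, e, e)
  have mF := measurable_tensorForce hu.contDiff hv.contDiff
  have mT : Measurable (tensorConj u v) :=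
    (contDiff_tensorConj hu.contDiff hv.contDiff).continuous.measurable
  have mu := hu.measurable_derivSize e f
  have mv := hv.measurable_derivSize e f
  have mZ : Measurable (tensorSize e f u v) := by unfold tensorSize; fun_prop
  have mJ := measurable_timeWindow
  have hM := bumpBound_nonneg
  set Y := (ENNReal.ofReal (8 * bumpBound)) * (L * (massSup u * massSup v)) + 4 * (L * Q) with hY
  have bound : ∀ T : ℝ, 1 ≤ T →
      ∫⁻ q : TwoBody, ENNReal.ofReal (cutoff T (T ^ 2) q * (2 * virialDensity l₂ e q.2)) *
        ‖dirDeriv (0, e, e) (tensorConj u v) q‖ₑ ^ 2 ≤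
      ENNReal.ofReal (8 * bumpBound / T) * (18 * (S * S') + Q) + Y := by
    intro T hT
    have hT0 : 0 < T := by linarith
    refine (lintegral_cutoff_virialDensity_le hu.contDiff hv.contDiff hl₂ h hT).trans ?_
    rw [lintegral_add_right _ (by fun_prop), lintegral_add_right _ (by fun_prop),
      lintegral_add_right _ (by fun_prop), lintegral_const_mul' _ _ (by finiteness),
      lintegral_const_mul' _ _ (by finiteness), lintegral_const_mul' _ _ (by finiteness),
      lintegral_const_mul' _ _ (by finiteness)]
    have i1 : ∫⁻ q : TwoBody, timeWindow T q.1 * tensorSize e f u v q ^ 2 ≤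
        ENNReal.ofReal (4 * T) * (S * S') := by
      simp only [tensorSize, mul_pow]
      rw [← lintegral_timeWindow T]
      exact lintegral_twoBody_le_time (α := fun p => derivSize e f u p ^ 2)
        (β := fun p => derivSize e f v p ^ 2) (by fun_prop) (by fun_prop) (mJ T) hSu hSv
    have i2 := lintegral_timeWindow_mul_dirDeriv_le hu hv hl₁ hl₂ he T
    have i3 := lintegral_tensorForce_mul_tensorConj_le hu hv
    have i4 := lintegral_tensorForce_mul_dirDeriv_le hu hv hl₁ hl₂ he
    rw [← hL] at i2 i4
    rw [← hQ] at i3 i4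
    have c1 : ENNReal.ofReal (2 * bumpBound / T ^ 2) * ENNReal.ofReal (4 * T) =
        ENNReal.ofReal (8 * bumpBound / T) := by
      rw [← ENNReal.ofReal_mul (by positivity)]
      congr 1
      field_simp
      ring
    have c2 : ENNReal.ofReal (2 * bumpBound / T) * ENNReal.ofReal (4 * T) =
        ENNReal.ofReal (8 * bumpBound) := by
      rw [← ENNReal.ofReal_mul (by positivity)]
      congr 1
      field_simp
      ring
    have c3 : ENNReal.ofReal (2 * bumpBound / T ^ 2) ≤ ENNReal.ofReal (8 * bumpBound / T) := by
      refine ENNReal.ofReal_le_ofReal ?_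
      rw [div_le_div_iff₀ (by positivity) hT0]
      nlinarith [mul_nonneg hM hT0.le, mul_nonneg (mul_nonneg hM hT0.le) (sub_nonneg.2 hT)]
    calc _ ≤ 18 * ENNReal.ofReal (2 * bumpBound / T ^ 2) * (ENNReal.ofReal (4 * T) * (S * S')) +
          ENNReal.ofReal (2 * bumpBound / T) *
            (ENNReal.ofReal (4 * T) * (L * (massSup u * massSup v))) +
          ENNReal.ofReal (8 * bumpBound / T) * Q + 4 * (L * Q) :=
          add_le_add (add_le_add (add_le_add (mul_le_mul' le_rfl i1) (mul_le_mul' le_rfl i2))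
            (mul_le_mul' c3 i3)) (mul_le_mul' le_rfl i4)
      _ = _ := by
          rw [hY, ← c2, ← mul_assoc (18 * _), mul_assoc 18, c1]
          ring
  have lim : Filter.Tendsto (fun n : ℕ => ENNReal.ofReal (8 * bumpBound / ((n : ℝ) + 1)) *
      (18 * (S * S') + Q) + Y) Filter.atTop (nhds Y) := by
    have h0 : Filter.Tendsto (fun n : ℕ => ENNReal.ofReal (8 * bumpBound / ((n : ℝ) + 1)))
        Filter.atTop (nhds 0) := by
      rw [← ENNReal.ofReal_zero]
      refine ENNReal.tendsto_ofReal ?_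
      exact tendsto_const_nhds.div_atTop
        (tendsto_natCast_atTop_atTop.atTop_add tendsto_const_nhds)
    have h1 := (ENNReal.Tendsto.mul_const (b := 18 * (S * S') + Q) h0
      (Or.inr (by finiteness))).add_const Y
    simpa using h1
  have cut : ∀ q : TwoBody, ∀ᶠ n : ℕ in Filter.atTop,
      cutoff ((n : ℝ) + 1) (((n : ℝ) + 1) ^ 2) q = 1 := by
    intro q
    obtain ⟨N, hN⟩ := exists_nat_ge (|q.1| + ‖q.2‖)
    filter_upwards [Filter.eventually_ge_atTop N] with n hn
    have hn' : (N : ℝ) ≤ n := by exact_mod_cast hn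
    have := norm_nonneg q.2
    have := abs_nonneg q.1
    refine cutoff_eq_one (by positivity) (by positivity) (by linarith) ?_
    nlinarith
  calc ∫⁻ q : TwoBody, ENNReal.ofReal (virialDensity l₂ e q.2) *
        ‖dirDeriv (0, e, e) (tensorConj u v) q‖ₑ ^ 2
      ≤ ∫⁻ q : TwoBody, Filter.liminf (fun n : ℕ =>
          ENNReal.ofReal (cutoff ((n : ℝ) + 1) (((n : ℝ) + 1) ^ 2) q *
            (2 * virialDensity l₂ e q.2)) *
          ‖dirDeriv (0, e, e) (tensorConj u v) q‖ₑ ^ 2) Filter.atTop := by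
        refine lintegral_mono fun q => Filter.le_liminf_of_le (by isBoundedDefault) ?_
        filter_upwards [cut q] with n hn
        rw [hn, one_mul]
        gcongr
        linarith [virialDensity_nonneg hl₂.le e q.2]
    _ ≤ Filter.liminf (fun n : ℕ => ∫⁻ q : TwoBody,
          ENNReal.ofReal (cutoff ((n : ℝ) + 1) (((n : ℝ) + 1) ^ 2) q *
            (2 * virialDensity l₂ e q.2)) *
          ‖dirDeriv (0, e, e) (tensorConj u v) q‖ₑ ^ 2) Filter.atTop := by
        refine lintegral_liminf_le fun n => ?_
        have m1 := (contDiff_cutoff ((n : ℝ) + 1) (((n : ℝ) + 1) ^ 2)).continuous.measurable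
        have m2 := (continuous_virialDensity l₂ e).measurable
        fun_prop
    _ ≤ Filter.liminf (fun n : ℕ => ENNReal.ofReal (8 * bumpBound / ((n : ℝ) + 1)) *
          (18 * (S * S') + Q) + Y) Filter.atTop :=
        Filter.liminf_le_liminf (Filter.Eventually.of_forall fun n => bound _ (by simp))
    _ = Y := lim.liminf_eq
    _ ≤ virialConst * ENNReal.ofReal (l₁ + l₂) * bilinearEnergy u v := by
        rw [hY, hL, virialConst, bilinearEnergy, ← hQ]
        calc _ ≤ (ENNReal.ofReal (8 * bumpBound) + 4) *
              (kernelMass * ENNReal.ofReal (l₁ + l₂) * (massSup u * massSup v)) +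
              (ENNReal.ofReal (8 * bumpBound) + 4) *
              (kernelMass * ENNReal.ofReal (l₁ + l₂) * Q) := by
              gcongr
              · exact le_self_add
              · exact le_add_self
          _ = _ := by ring

end Estimates

lemma lintegral_comp_affine {F : ℝ × ℝ → ℝ≥0∞} (hF : Measurable F) {l : ℝ} (hl : 0 < l)
    (x : ℝ × ℝ) : ∫⁻ z, F (x + l⁻¹ • z) = ENNReal.ofReal (l ^ 2) * ∫⁻ y, F y := by
  have hm : Measurable fun z => F (x + z) := by fun_prop
  have h := lintegral_map (μ := (volume : Measure (ℝ × ℝ))) hm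
    (measurable_const_smul (α := ℝ × ℝ) l⁻¹)
  have e : (fun z : ℝ × ℝ => l⁻¹ • z) = (l⁻¹ • · ) := rfl
  rw [Measure.map_addHaar_smul _ (inv_ne_zero hl.ne'), lintegral_smul_measure,
    lintegral_add_left_eq_self] at h
  rw [← h]
  simp [abs_of_pos hl]

/-- The weighted square norm of the reproducing kernel. -/
def kernelEnergy : ℝ≥0∞ := ∫⁻ z : ℝ × ℝ, ‖bandKernel z‖ₑ ^ 2 * ENNReal.ofReal (1 + ‖z‖ ^ 2)

lemma kernelEnergy_ne_top : kernelEnergy ≠ ∞ := by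
  obtain ⟨C₀, _, h₀⟩ := bandKernel.decay 0 0
  obtain ⟨C₂, _, h₂⟩ := bandKernel.decay 2 0
  have hb : ∀ z : ℝ × ℝ, ‖bandKernel z‖ₑ ^ 2 * ENNReal.ofReal (1 + ‖z‖ ^ 2) ≤
      ENNReal.ofReal (C₀ + C₂) * ‖bandKernel z‖ₑ := by
    intro z
    rw [sq, mul_assoc, mul_comm]
    refine mul_le_mul' ?_ le_rfl
    rw [← ofReal_norm, ← ENNReal.ofReal_mul (norm_nonneg _)]
    refine ENNReal.ofReal_le_ofReal ?_
    have a := h₀ z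
    have b := h₂ z
    simp only [norm_iteratedFDeriv_zero, pow_zero, one_mul] at a b
    linarith
  refine ne_top_of_le_ne_top ?_ (lintegral_mono hb)
  rw [lintegral_const_mul' _ _ (by finiteness)]
  exact ENNReal.mul_ne_top (by finiteness) (SchwartzMap.integrable bandKernel).2.ne

lemma BandLimited.integrable_bandKernel_mul {l : ℝ} {v : ℝ × ℝ × ℝ → ℂ} (hv : BandLimited l v)
    (hl : 0 < l) (t : ℝ) (x : ℝ × ℝ) :
    Integrable fun z => bandKernel z * v (t, x + l⁻¹ • z) := by
  obtain ⟨g, hg⟩ := hv.slice t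
  have h := (mulSchwartz bandKernel (affineComp g hl.ne' x)).integrable (μ := volume)
  refine h.congr (Filter.Eventually.of_forall fun z => ?_)
  simp only [mulSchwartz_apply, affineComp_apply, hg]

lemma BandLimited.diagonal_eq_integral {l : ℝ} {u v : ℝ × ℝ × ℝ → ℂ}
    (hu : ContDiff ℝ (⊤ : ℕ∞) u) (hv : BandLimited l v) (hl : 0 < l) (e : ℝ × ℝ) (t : ℝ)
    (x : ℝ × ℝ) :
    dirDeriv (0, e, e) (tensorConj u v) (t, x, x) =
      ∫ z, conj (bandKernel z) * dirDeriv (0, e, e) (tensorConj u v) (t, x, x + l⁻¹ • z) := by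
  have i1 := (hv.integrable_bandKernel_mul hl t x).const_mul (conj (_root_.spaceDeriv e u (t, x)))
  have i2 := ((hv.spaceDeriv e).integrable_bandKernel_mul hl t x).const_mul (conj (u (t, x)))
  rw [dirDeriv_center_tensorConj hu hv.contDiff]
  simp only [tensorConj]
  rw [hv.eq_integral hl t x, (hv.spaceDeriv e).eq_integral hl t x]
  have h : ∀ z, conj (bandKernel z) *
      (_root_.spaceDeriv e u (t, x) * conj (v (t, x + l⁻¹ • z)) +
        u (t, x) * conj (_root_.spaceDeriv e v (t, x + l⁻¹ • z))) =
      conj (conj (_root_.spaceDeriv e u (t, x)) * (bandKernel z * v (t, x + l⁻¹ • z)) +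
        conj (u (t, x)) * (bandKernel z * _root_.spaceDeriv e v (t, x + l⁻¹ • z))) := by
    intro z
    simp only [map_add, map_mul, Complex.conj_conj]
    ring
  simp only [h]
  rw [integral_conj, integral_add i1 i2, integral_const_mul, integral_const_mul]
  simp only [map_add, map_mul, Complex.conj_conj]

lemma virialDensity_affine {l : ℝ} (hl : 0 < l) {e : ℝ × ℝ} (he : IsAxis e) (x z : ℝ × ℝ) :
    l ≤ (1 + ‖z‖ ^ 2) * virialDensity l e (x, x + l⁻¹ • z) := by
  have h : (l * relCoord e (x, x + l⁻¹ • z)) ^ 2 ≤ ‖z‖ ^ 2 := by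
    rw [relCoord_apply, sq_le_sq, abs_norm]
    rcases he with rfl | rfl
    · have := norm_fst_le z
      simp only [Prod.fst_add, Prod.smul_fst, smul_eq_mul, sub_add_cancel_left]
      rw [show l * (1 * -(l⁻¹ * z.1) + 0 * (x.2 - (x + l⁻¹ • z).2)) = -z.1 by field_simp; ring,
        abs_neg]
      exact this
    · have := norm_snd_le z
      simp only [Prod.snd_add, Prod.smul_snd, smul_eq_mul, sub_add_cancel_left]
      rw [show l * (0 * (x.1 - (x + l⁻¹ • z).1) + 1 * -(l⁻¹ * z.2)) = -z.2 by field_simp; ring,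
        abs_neg]
      exact this
  unfold virialDensity
  rw [← mul_div_assoc, le_div_iff₀ (by positivity)]
  nlinarith

lemma BandLimited.lintegral_diagonal_le {l : ℝ} {u v : ℝ × ℝ × ℝ → ℂ}
    (hu : ContDiff ℝ (⊤ : ℕ∞) u) (hv : BandLimited l v) (hl : 0 < l) {e : ℝ × ℝ}
    (he : IsAxis e) :
    ∫⁻ p : ℝ × ℝ × ℝ, ‖dirDeriv (0, e, e) (tensorConj u v) (p.1, p.2, p.2)‖ₑ ^ 2 ≤
      kernelEnergy * ENNReal.ofReal l * ∫⁻ q : TwoBody,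
        ENNReal.ofReal (virialDensity l e q.2) *
          ‖dirDeriv (0, e, e) (tensorConj u v) q‖ₑ ^ 2 := by
  set W := dirDeriv (0, e, e) (tensorConj u v) with hW
  have mW : Measurable W := measurable_dirDeriv_tensorConj hu hv.contDiff _
  have mD := (continuous_virialDensity l e).measurable
  have mk : Measurable bandKernel := (SchwartzMap.continuous _).measurable
  have hpt : ∀ (t : ℝ) (x : ℝ × ℝ), ‖W (t, x, x)‖ₑ ^ 2 ≤ kernelEnergy * ENNReal.ofReal l *
      ∫⁻ y, ENNReal.ofReal (virialDensity l e (x, y)) * ‖W (t, x, y)‖ₑ ^ 2 := by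
    intro t x
    have m1 : Measurable fun z : ℝ × ℝ => ‖W (t, x, x + l⁻¹ • z)‖ₑ := by fun_prop
    have m3 : Measurable fun y : ℝ × ℝ =>
        ENNReal.ofReal (virialDensity l e (x, y)) * ‖W (t, x, y)‖ₑ ^ 2 := by fun_prop
    calc ‖W (t, x, x)‖ₑ ^ 2 ≤ (∫⁻ z, ‖bandKernel z‖ₑ * ‖W (t, x, x + l⁻¹ • z)‖ₑ) ^ 2 := by
          rw [hW, BandLimited.diagonal_eq_integral hu hv hl]
          refine pow_le_pow_left₀ zero_le ((enorm_integral_le_lintegral_enorm _).trans_eq ?_) 2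
          simp only [enorm_mul, enorm_conj]
      _ = (∫⁻ z, (‖bandKernel z‖ₑ * ENNReal.ofReal (1 + ‖z‖ ^ 2) ^ (1 / 2 : ℝ)) *
            ((ENNReal.ofReal (1 + ‖z‖ ^ 2) ^ (1 / 2 : ℝ))⁻¹ * ‖W (t, x, x + l⁻¹ • z)‖ₑ)) ^ 2 := by
          congr 2 with z
          have hp : 0 < 1 + ‖z‖ ^ 2 := by positivity
          rw [mul_assoc, ← mul_assoc (_ ^ _), ENNReal.mul_inv_cancel, one_mul]
          · simp [hp]
          · simp
      _ ≤ _ * ∫⁻ z, ((ENNReal.ofReal (1 + ‖z‖ ^ 2) ^ (1 / 2 : ℝ))⁻¹ *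
            ‖W (t, x, x + l⁻¹ • z)‖ₑ) ^ 2 :=
          sq_lintegral_mul_le (by fun_prop) (by fun_prop)
      _ ≤ kernelEnergy * ∫⁻ z, ENNReal.ofReal l⁻¹ *
            (ENNReal.ofReal (virialDensity l e (x, x + l⁻¹ • z)) *
              ‖W (t, x, x + l⁻¹ • z)‖ₑ ^ 2) := by
          have hs : ∀ a : ℝ≥0∞, (a ^ (1 / 2 : ℝ)) ^ 2 = a := fun a => by
            rw [← ENNReal.rpow_natCast, ← ENNReal.rpow_mul]; norm_num
          simp only [mul_pow, ← ENNReal.inv_pow, hs]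
          refine mul_le_mul' le_rfl (lintegral_mono fun z => ?_)
          simp only
          rw [← mul_assoc]
          refine mul_le_mul' ?_ le_rfl
          have hp : 0 < 1 + ‖z‖ ^ 2 := by positivity
          rw [← ENNReal.ofReal_inv_of_pos hp, ← ENNReal.ofReal_mul (by positivity)]
          refine ENNReal.ofReal_le_ofReal ?_
          have := virialDensity_affine hl he x z
          rw [inv_mul_eq_div, le_div_iff₀ hl, inv_mul_le_iff₀ hp]
          exact this
      _ = kernelEnergy * (ENNReal.ofReal l⁻¹ * (ENNReal.ofReal (l ^ 2) *
            ∫⁻ y, ENNReal.ofReal (virialDensity l e (x, y)) * ‖W (t, x, y)‖ₑ ^ 2)) := by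
          rw [lintegral_const_mul' _ _ (by finiteness), ← lintegral_comp_affine m3 hl x]
      _ = _ := by
          rw [← mul_assoc (ENNReal.ofReal l⁻¹), ← ENNReal.ofReal_mul (by positivity), sq,
            inv_mul_cancel_left₀ hl.ne', mul_assoc]
  have mI : Measurable fun q : TwoBody =>
      ENNReal.ofReal (virialDensity l e q.2) * ‖W q‖ₑ ^ 2 := by fun_prop
  calc _ = ∫⁻ t, ∫⁻ x : ℝ × ℝ, ‖W (t, x, x)‖ₑ ^ 2 :=
        lintegral_spaceTime (α := fun p => ‖W (p.1, p.2, p.2)‖ₑ ^ 2) (by fun_prop)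
    _ ≤ ∫⁻ t, ∫⁻ x : ℝ × ℝ, kernelEnergy * ENNReal.ofReal l *
          ∫⁻ y, ENNReal.ofReal (virialDensity l e (x, y)) * ‖W (t, x, y)‖ₑ ^ 2 :=
        lintegral_mono fun t => lintegral_mono fun x => hpt t x
    _ = kernelEnergy * ENNReal.ofReal l * ∫⁻ t, ∫⁻ x : ℝ × ℝ,
          ∫⁻ y, ENNReal.ofReal (virialDensity l e (x, y)) * ‖W (t, x, y)‖ₑ ^ 2 := by
        have hc : kernelEnergy * ENNReal.ofReal l ≠ ∞ :=
          ENNReal.mul_ne_top kernelEnergy_ne_top ENNReal.ofReal_ne_top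
        simp only [lintegral_const_mul' _ _ hc]
    _ = _ := by
        rw [Measure.volume_eq_prod ℝ ((ℝ × ℝ) × (ℝ × ℝ)), lintegral_prod _ mI.aemeasurable]
        congr 1
        refine lintegral_congr fun t => ?_
        have mt : Measurable fun z : (ℝ × ℝ) × (ℝ × ℝ) =>
          ENNReal.ofReal (virialDensity l e z) * ‖W (t, z)‖ₑ ^ 2 := by fun_prop
        rw [Measure.volume_eq_prod (ℝ × ℝ) (ℝ × ℝ), lintegral_prod _ mt.aemeasurable]

lemma spaceDeriv_mul_conj {u v : ℝ × ℝ × ℝ → ℂ} (hu : ContDiff ℝ (⊤ : ℕ∞) u)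
    (hv : ContDiff ℝ (⊤ : ℕ∞) v) (e : ℝ × ℝ) (p : ℝ × ℝ × ℝ) :
    spaceDeriv e (fun p => u p * conj (v p)) p =
      dirDeriv (0, e, e) (tensorConj u v) (p.1, p.2, p.2) := by
  have hc : ContDiff ℝ (⊤ : ℕ∞) fun p => conj (v p) :=
    (Complex.conjCLE : ℂ →L[ℝ] ℂ).contDiff.comp hv
  rw [dirDeriv_center_tensorConj hu hv]
  change dirDeriv (0, e) (fun p => u p * conj (v p)) p = _
  rw [dirDeriv_mul hu hc, dirDeriv_conj hv]
  simp only [tensorConj]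
  change _ = dirDeriv (0, e) u p * conj (v p) + u p * conj (dirDeriv (0, e) v p)
  ring

lemma isFrame_fst : IsFrame (1, 0) (0, 1) 1 := Or.inl ⟨rfl, rfl, rfl⟩

lemma isFrame_snd : IsFrame (0, 1) (1, 0) (-1) := Or.inr ⟨rfl, rfl, rfl⟩

/-- The bilinear estimate for a pair of solutions at separated frequencies. -/
lemma lintegral_mul_sq_le_of_separated {l₁ l₂ a : ℝ} {u v : ℝ × ℝ × ℝ → ℂ}
    (hu : BandLimited l₁ u) (hv : BandLimited l₂ v) (hl₁ : 0 < l₁) (hl₂ : 0 < l₂) (ha : 0 ≤ a)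
    (hau : ∀ (t : ℝ) (ξ : ℝ × ℝ), spatialFourier (fun x => u (t, x)) ξ ≠ 0 → a ≤ elen ξ)
    (hav : ∀ (t : ℝ) (ξ : ℝ × ℝ), spatialFourier (fun x => v (t, x)) ξ ≠ 0 → elen ξ ≤ a / 2)
    (hA : massSup u ≠ ∞) (hB : massSup v ≠ ∞)
    (hI : interact u (hypSchrod u) ≠ ∞) (hI' : interact v (hypSchrod v) ≠ ∞) :
    ENNReal.ofReal a ^ 2 * ∫⁻ p, ‖u p * v p‖ₑ ^ 2 ≤
      2 * (kernelEnergy * ENNReal.ofReal l₂ *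
        (virialConst * ENNReal.ofReal (l₁ + l₂) * bilinearEnergy u v)) := by
  set D : ℝ × ℝ → ℝ × ℝ × ℝ → ℝ≥0∞ := fun e p =>
    ‖dirDeriv (0, e, e) (tensorConj u v) (p.1, p.2, p.2)‖ₑ ^ 2 with hD
  have mD : ∀ e, Measurable (D e) := fun e => by
    have := measurable_dirDeriv_tensorConj hu.contDiff hv.contDiff (0, e, e)
    fun_prop
  have mu := hu.measurable
  have mv := hv.measurable
  have slice : ∀ t : ℝ, ENNReal.ofReal a ^ 2 * ∫⁻ x : ℝ × ℝ, ‖u (t, x) * v (t, x)‖ₑ ^ 2 ≤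
      (∫⁻ x : ℝ × ℝ, D (1, 0) (t, x)) + ∫⁻ x : ℝ × ℝ, D (0, 1) (t, x) := by
    intro t
    obtain ⟨g, hg⟩ := hu.slice t
    obtain ⟨k, hk⟩ := hv.slice t
    have h1 := hau t
    have h2 := hav t
    rw [← funext hg] at h1
    rw [← funext hk] at h2
    have hw : ContDiff ℝ (⊤ : ℕ∞) fun p => u p * conj (v p) :=
      hu.contDiff.mul ((Complex.conjCLE : ℂ →L[ℝ] ℂ).contDiff.comp hv.contDiff)
    have hs : ∀ x, mulSchwartz g (conjSchwartz k) x = (fun p => u p * conj (v p)) (t, x) := by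
      intro x
      rw [mulSchwartz_apply, conjSchwartz_apply, hg, hk]
    have h := lintegral_enorm_sq_le_of_highFrequency (mulSchwartz g (conjSchwartz k)) ha
      (spatialFourier_mul_conj_support h1 h2)
    simp only [spaceDeriv_slice hw hs, spaceDeriv_mul_conj hu.contDiff hv.contDiff, hs,
      enorm_mul, enorm_conj] at h
    simpa only [enorm_mul] using h
  have dir : ∀ {e f : ℝ × ℝ} {σ : ℂ}, IsFrame e f σ → ∫⁻ p, D e p ≤
      kernelEnergy * ENNReal.ofReal l₂ *
        (virialConst * ENNReal.ofReal (l₁ + l₂) * bilinearEnergy u v) := fun h =>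
    (BandLimited.lintegral_diagonal_le hu.contDiff hv hl₂ h.isAxis_left).trans
      (mul_le_mul' le_rfl (lintegral_virialDensity_le hu hv hl₁ hl₂ h hA hB hI hI'))
  calc ENNReal.ofReal a ^ 2 * ∫⁻ p, ‖u p * v p‖ₑ ^ 2
      = ∫⁻ t, ENNReal.ofReal a ^ 2 * ∫⁻ x : ℝ × ℝ, ‖u (t, x) * v (t, x)‖ₑ ^ 2 := by
        rw [lintegral_spaceTime (by fun_prop), lintegral_const_mul' _ _ (by finiteness)]
    _ ≤ ∫⁻ t, ((∫⁻ x : ℝ × ℝ, D (1, 0) (t, x)) + ∫⁻ x : ℝ × ℝ, D (0, 1) (t, x)) :=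
        lintegral_mono slice
    _ = (∫⁻ p, D (1, 0) p) + ∫⁻ p, D (0, 1) p := by
        rw [lintegral_add_left (mD _).lintegral_prod_right', lintegral_spaceTime (mD _),
          lintegral_spaceTime (mD _)]
    _ ≤ _ := by
        rw [two_mul]
        exact add_le_add (dir isFrame_fst) (dir isFrame_snd)

/-- Smooth space-time functions with Schwartz time slices and spatial frequencies of size about
`2 ^ k`. -/
structure FreqLocalized (k : ℤ) (u : ℝ × ℝ × ℝ → ℂ) : Prop where
  contDiff : ContDiff ℝ (⊤ : ℕ∞) u
  slice : ∀ t : ℝ, ∃ g : 𝓢(ℝ × ℝ, ℂ), ∀ x : ℝ × ℝ, g x = u (t, x)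
  elen_mem : ∀ (t : ℝ) (ξ : ℝ × ℝ), spatialFourier (fun x => u (t, x)) ξ ≠ 0 →
    (2 : ℝ) ^ (k - 1) ≤ elen ξ ∧ elen ξ ≤ (2 : ℝ) ^ (k + 1)

/-- The spatial translate `u^y`. -/
def spaceTranslate (y : ℝ × ℝ) (u : ℝ × ℝ × ℝ → ℂ) (p : ℝ × ℝ × ℝ) : ℂ := u (p - (0, y))

lemma spaceTranslate_apply (y : ℝ × ℝ) (u : ℝ × ℝ × ℝ → ℂ) (t : ℝ) (x : ℝ × ℝ) :
    spaceTranslate y u (t, x) = u (t, x - y) := by simp [spaceTranslate]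

lemma dirDeriv_spaceTranslate (y : ℝ × ℝ) (u : ℝ × ℝ × ℝ → ℂ) (e : ℝ × ℝ × ℝ) :
    dirDeriv e (spaceTranslate y u) = spaceTranslate y (dirDeriv e u) := by
  ext p
  simp only [dirDeriv, spaceTranslate]
  rw [← fderiv_comp_sub]
  rfl

lemma hypSchrod_spaceTranslate (y : ℝ × ℝ) (u : ℝ × ℝ × ℝ → ℂ) :
    hypSchrod (spaceTranslate y u) = spaceTranslate y (hypSchrod u) := by
  ext p
  change Complex.I * dirDeriv _ (spaceTranslate y u) p
    + dirDeriv _ (dirDeriv _ (spaceTranslate y u)) p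
    - dirDeriv _ (dirDeriv _ (spaceTranslate y u)) p = _
  simp only [dirDeriv_spaceTranslate]
  rfl

instance : (volume : Measure (ℝ × ℝ × ℝ)).IsAddHaarMeasure :=
  isAddHaarMeasure_prod inferInstance (isAddHaarMeasure_prod inferInstance inferInstance)

lemma interact_spaceTranslate (y : ℝ × ℝ) (u N : ℝ × ℝ × ℝ → ℂ) :
    interact (spaceTranslate y u) (spaceTranslate y N) = interact u N := by
  unfold interact
  congr 1 with z
  rw [← lintegral_sub_right_eq_self (fun p : ℝ × ℝ × ℝ =>
    (‖u (p.1, p.2.1 - z.1, p.2.2 - z.2)‖₊ : ℝ≥0∞) * (‖N p‖₊ : ℝ≥0∞)) ((0, y) : ℝ × ℝ × ℝ)]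
  refine lintegral_congr fun p => ?_
  rw [spaceTranslate_apply]
  simp only [spaceTranslate, Prod.fst_sub, Prod.snd_sub, sub_zero]
  congr 5
  ext <;> simp [sub_right_comm]

lemma massSup_spaceTranslate (y : ℝ × ℝ) (u : ℝ × ℝ × ℝ → ℂ) :
    massSup (spaceTranslate y u) = massSup u := by
  unfold massSup
  congr 1 with t
  simp only [spaceTranslate_apply]
  exact lintegral_sub_right_eq_self (fun x => ‖u (t, x)‖ₑ ^ 2) y

lemma LinfL2_spaceTranslate (y : ℝ × ℝ) (u : ℝ × ℝ × ℝ → ℂ) :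
    LinfL2 (spaceTranslate y u) = LinfL2 u := by
  have h : LinfL2 (spaceTranslate y u) ^ 2 = LinfL2 u ^ 2 := by
    rw [← massSup_eq, ← massSup_eq, massSup_spaceTranslate]
  exact le_antisymm (ENNReal_le_of_sq_le_sq h.le) (ENNReal_le_of_sq_le_sq h.ge)

lemma L4norm_spaceTranslate (y : ℝ × ℝ) (u : ℝ × ℝ × ℝ → ℂ) :
    L4norm (spaceTranslate y u) = L4norm u := by
  unfold L4norm spaceTranslate
  rw [lintegral_sub_right_eq_self (fun p => (‖u p‖₊ : ℝ≥0∞) ^ 4)]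

lemma FreqLocalized.spaceTranslate {k : ℤ} {u : ℝ × ℝ × ℝ → ℂ} (hu : FreqLocalized k u)
    (y : ℝ × ℝ) : FreqLocalized k (spaceTranslate y u) where
  contDiff := hu.contDiff.comp (contDiff_id.sub contDiff_const)
  slice t := by
    obtain ⟨g, hg⟩ := hu.slice t
    exact ⟨SchwartzMap.compSubConstCLM ℂ y g, fun x => by
      rw [spaceTranslate_apply, ← hg]; rfl⟩
  elen_mem t ξ hξ := by
    obtain ⟨g, hg⟩ := hu.slice t
    have h : (fun x => _root_.spaceTranslate y u (t, x)) = fun x => g (-y + (1 : ℝ)⁻¹ • x) := by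
      ext x
      rw [spaceTranslate_apply, hg]
      simp [sub_eq_neg_add]
    rw [h, spatialFourier_comp_affine g one_pos, one_smul] at hξ
    refine hu.elen_mem t ξ ?_
    rw [← funext hg]
    exact right_ne_zero_of_mul hξ

lemma FreqLocalized.bandLimited {k : ℤ} {u : ℝ × ℝ × ℝ → ℂ} (hu : FreqLocalized k u) :
    BandLimited ((2 : ℝ) ^ k) u where
  contDiff := hu.contDiff
  slice := hu.slice
  elen_le t ξ hξ := (hu.elen_mem t ξ hξ).2.trans_eq (by
    rw [zpow_add₀ two_ne_zero, zpow_one, mul_comm])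

/-- The norm of a solution of the inhomogeneous equation. -/
def solutionNorm (u : ℝ × ℝ × ℝ → ℂ) : ℝ≥0∞ :=
  L4norm u + LinfL2 u + interact u (hypSchrod u) ^ (1 / 2 : ℝ)

lemma solutionNorm_spaceTranslate (y : ℝ × ℝ) (u : ℝ × ℝ × ℝ → ℂ) :
    solutionNorm (spaceTranslate y u) = solutionNorm u := by
  unfold solutionNorm
  rw [hypSchrod_spaceTranslate, interact_spaceTranslate, LinfL2_spaceTranslate,
    L4norm_spaceTranslate]

lemma L4norm_le_solutionNorm (u : ℝ × ℝ × ℝ → ℂ) : L4norm u ≤ solutionNorm u :=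
  le_self_add.trans le_self_add

lemma rpow_half_sq (a : ℝ≥0∞) : (a ^ (1 / 2 : ℝ)) ^ 2 = a := by
  rw [← ENNReal.rpow_natCast, ← ENNReal.rpow_mul]
  norm_num

lemma massSup_add_interact_le (u : ℝ × ℝ × ℝ → ℂ) :
    massSup u + interact u (hypSchrod u) ≤ solutionNorm u ^ 2 := by
  rw [massSup_eq, ← rpow_half_sq (interact u (hypSchrod u)), solutionNorm, add_assoc]
  refine le_trans ?_ (pow_le_pow_left₀ (zero_le) le_add_self 2)
  rw [add_sq]
  gcongr
  exact le_self_add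

lemma bilinearEnergy_le (u v : ℝ × ℝ × ℝ → ℂ) :
    bilinearEnergy u v ≤ (solutionNorm u * solutionNorm v) ^ 2 := by
  rw [mul_pow]
  refine le_trans ?_ (mul_le_mul' (massSup_add_interact_le u) (massSup_add_interact_le v))
  unfold bilinearEnergy
  refine le_trans le_self_add (b := _ + interact u (hypSchrod u) * interact v (hypSchrod v))
    (le_of_eq ?_)
  ring

lemma L2norm_sq (w : ℝ × ℝ × ℝ → ℂ) : L2norm w ^ 2 = ∫⁻ p, ‖w p‖ₑ ^ 2 := rpow_half_sq _

lemma L2norm_mul_le {u v : ℝ × ℝ × ℝ → ℂ} (hu : Measurable u) (hv : Measurable v) :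
    L2norm (fun p => u p * v p) ≤ L4norm u * L4norm v := by
  have h4 : ∀ w : ℝ × ℝ × ℝ → ℂ, (L4norm w ^ 2) ^ 2 = ∫⁻ p, (‖w p‖ₑ ^ 2) ^ 2 := fun w => by
    unfold L4norm
    rw [← pow_mul, ← ENNReal.rpow_natCast, ← ENNReal.rpow_mul]
    norm_num
    simp only [← pow_mul]
    rfl
  refine ENNReal_le_of_sq_le_sq (ENNReal_le_of_sq_le_sq ?_)
  rw [L2norm_sq, mul_pow, mul_pow, h4, h4]
  simp only [enorm_mul, mul_pow]
  exact sq_lintegral_mul_le (by fun_prop) (by fun_prop)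

/-- The constant in the bilinear estimate at separated frequencies. -/
def separatedConst : ℝ≥0∞ := (16 * (kernelEnergy * virialConst)) ^ (1 / 2 : ℝ)

lemma separatedConst_ne_top : separatedConst ≠ ∞ := by
  have := kernelEnergy_ne_top
  have := virialConst_ne_top
  unfold separatedConst
  finiteness

lemma FreqLocalized.L2norm_mul_le {k₁ k₂ : ℤ} {u v : ℝ × ℝ × ℝ → ℂ} (hu : FreqLocalized k₁ u)
    (hv : FreqLocalized k₂ v) (hk : k₂ + 3 ≤ k₁) (hX : solutionNorm u ≠ ∞)
    (hY : solutionNorm v ≠ ∞) :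
    L2norm (fun p => u p * v p) ≤ separatedConst *
      (2 : ℝ≥0∞) ^ (-|(k₁ : ℝ) - (k₂ : ℝ)| / 2) * solutionNorm u * solutionNorm v := by
  have ne : ∀ w : ℝ × ℝ × ℝ → ℂ, solutionNorm w ≠ ∞ →
      massSup w ≠ ∞ ∧ interact w (hypSchrod w) ≠ ∞ := fun w hw =>
    ENNReal.add_ne_top.1 (ne_top_of_le_ne_top (ENNReal.pow_ne_top hw) (massSup_add_interact_le w))
  have l₁ : (0 : ℝ) < 2 ^ k₁ := by positivity
  have l₂ : (0 : ℝ) < 2 ^ k₂ := by positivity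
  have core := lintegral_mul_sq_le_of_separated (a := (2 : ℝ) ^ (k₁ - 1)) hu.bandLimited
    hv.bandLimited l₁ l₂ (by positivity) (fun t ξ h => (hu.elen_mem t ξ h).1)
    (fun t ξ h => (hv.elen_mem t ξ h).2.trans (by
      rw [div_eq_mul_inv, ← zpow_sub_one₀ two_ne_zero]
      exact zpow_le_zpow_right₀ one_le_two (by omega)))
    (ne u hX).1 (ne v hY).1 (ne u hX).2 (ne v hY).2
  set d : ℝ≥0∞ := (2 : ℝ≥0∞) ^ (-|(k₁ : ℝ) - (k₂ : ℝ)| / 2) with hd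
  have hd2 : d ^ 2 = ENNReal.ofReal (2 ^ k₂ / 2 ^ k₁) := by
    have : (k₂ : ℝ) ≤ k₁ := by exact_mod_cast (by omega : k₂ ≤ k₁)
    rw [hd, ← ENNReal.rpow_natCast, ← ENNReal.rpow_mul, abs_of_nonneg (by linarith),
      ← zpow_sub₀ two_ne_zero, ← Real.rpow_intCast, ← ENNReal.ofReal_rpow_of_pos two_pos]
    congr 1
    · simp
    · push_cast; ring
  have hinv : ENNReal.ofReal (((2 : ℝ) ^ (k₁ - 1))⁻¹ ^ 2) * ENNReal.ofReal ((2 : ℝ) ^ (k₁ - 1)) ^ 2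
      = 1 := by
    rw [← ENNReal.ofReal_pow (by positivity), ← ENNReal.ofReal_mul (by positivity), ← mul_pow,
      inv_mul_cancel₀ (by positivity)]
    simp
  have hnum : ENNReal.ofReal (((2 : ℝ) ^ (k₁ - 1))⁻¹ ^ 2) *
      (ENNReal.ofReal (2 ^ k₂) * ENNReal.ofReal (2 ^ k₁ + 2 ^ k₂)) ≤ 8 * d ^ 2 := by
    rw [hd2, ← ENNReal.ofReal_mul (by positivity), ← ENNReal.ofReal_mul (by positivity),
      ← ENNReal.ofReal_ofNat, ← ENNReal.ofReal_mul (by positivity)]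
    refine ENNReal.ofReal_le_ofReal ?_
    have : (2 : ℝ) ^ k₂ ≤ 2 ^ k₁ := zpow_le_zpow_right₀ one_le_two (by omega)
    rw [zpow_sub_one₀ two_ne_zero]
    field_simp
    nlinarith
  refine ENNReal_le_of_sq_le_sq ?_
  rw [L2norm_sq, mul_assoc, mul_pow, mul_pow, separatedConst, rpow_half_sq]
  calc ∫⁻ p, ‖u p * v p‖ₑ ^ 2
      = ENNReal.ofReal (((2 : ℝ) ^ (k₁ - 1))⁻¹ ^ 2) *
          (ENNReal.ofReal ((2 : ℝ) ^ (k₁ - 1)) ^ 2 * ∫⁻ p, ‖u p * v p‖ₑ ^ 2) := by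
        rw [← mul_assoc, hinv, one_mul]
    _ ≤ _ := mul_le_mul_right core _
    _ = 2 * (kernelEnergy * virialConst) * (ENNReal.ofReal (((2 : ℝ) ^ (k₁ - 1))⁻¹ ^ 2) *
          (ENNReal.ofReal (2 ^ k₂) * ENNReal.ofReal (2 ^ k₁ + 2 ^ k₂))) * bilinearEnergy u v := by
        ring
    _ ≤ 2 * (kernelEnergy * virialConst) * (8 * d ^ 2) * (solutionNorm u * solutionNorm v) ^ 2 := by
        gcongr
        exact bilinearEnergy_le u v
    _ = _ := by ring

lemma half_le_two_rpow {k₁ k₂ : ℤ} (h : |k₁ - k₂| ≤ 2) :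
    1 ≤ 2 * (2 : ℝ≥0∞) ^ (-|(k₁ : ℝ) - (k₂ : ℝ)| / 2) := by
  have h' : |(k₁ : ℝ) - k₂| ≤ 2 := by exact_mod_cast h
  nth_rewrite 1 [← ENNReal.rpow_one 2]
  rw [← ENNReal.rpow_add _ _ two_ne_zero (by simp)]
  rw [← ENNReal.rpow_zero (x := 2)]
  exact ENNReal.rpow_le_rpow_of_exponent_le one_le_two (by linarith)

lemma FreqLocalized.L2norm_mul_le_of_ne_top {k₁ k₂ : ℤ} {u v : ℝ × ℝ × ℝ → ℂ}
    (hu : FreqLocalized k₁ u) (hv : FreqLocalized k₂ v) (hX : solutionNorm u ≠ ∞)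
    (hY : solutionNorm v ≠ ∞) :
    L2norm (fun p => u p * v p) ≤ (separatedConst + 2) *
      (2 : ℝ≥0∞) ^ (-|(k₁ : ℝ) - (k₂ : ℝ)| / 2) * solutionNorm u * solutionNorm v := by
  rcases le_or_gt (k₂ + 3) k₁ with h | h
  · refine (hu.L2norm_mul_le hv h hX hY).trans ?_
    gcongr
    exact le_self_add
  rcases le_or_gt (k₁ + 3) k₂ with h' | h'
  · have := hv.L2norm_mul_le hu h' hY hX
    simp only [mul_comm (v _)] at this
    rw [abs_sub_comm, mul_right_comm] at this
    refine this.trans ?_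
    gcongr
    exact le_self_add
  calc L2norm (fun p => u p * v p) ≤ L4norm u * L4norm v :=
        _root_.L2norm_mul_le hu.bandLimited.measurable hv.bandLimited.measurable
    _ ≤ 1 * (solutionNorm u * solutionNorm v) := by
        rw [one_mul]
        exact mul_le_mul' (L4norm_le_solutionNorm u) (L4norm_le_solutionNorm v)
    _ ≤ (separatedConst + 2) * (2 : ℝ≥0∞) ^ (-|(k₁ : ℝ) - (k₂ : ℝ)| / 2) *
          (solutionNorm u * solutionNorm v) := by
        gcongr
        have hk : |k₁ - k₂| ≤ 2 := abs_le.2 ⟨by omega, by omega⟩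
        refine (half_le_two_rpow hk).trans ?_
        gcongr
        exact le_add_self
    _ = _ := by ring

lemma L2norm_mul_eq_zero {u v : ℝ × ℝ × ℝ → ℂ}
    (hu : Measurable u) (hv : Measurable v) (h : solutionNorm u = 0 ∨ solutionNorm v = 0) :
    L2norm (fun p => u p * v p) = 0 := by
  have key : ∀ {u v : ℝ × ℝ × ℝ → ℂ}, Measurable u → solutionNorm u = 0 →
      L2norm (fun p => u p * v p) = 0 := fun {u v} hu h => by
    have h4 : L4norm u = 0 := nonpos_iff_eq_zero.1 (h ▸ L4norm_le_solutionNorm u)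
    unfold L4norm at h4
    rw [ENNReal.rpow_eq_zero_iff_of_pos (by norm_num), lintegral_eq_zero_iff (by fun_prop)] at h4
    unfold L2norm
    rw [ENNReal.rpow_eq_zero_iff_of_pos (by norm_num)]
    refine lintegral_eq_zero_of_ae_eq_zero ?_
    filter_upwards [h4] with p hp
    have : u p = 0 := by simpa using hp
    simp [this]
  rcases h with h | h
  · exact key hu h
  · simpa only [mul_comm] using key (v := u) hv h

/-- Core bilinear estimate: for frequency-localized `u, v` at dyadic frequencies
`2^{k₁}, 2^{k₂}`,
`sup_y ‖u^y v‖_{L²} ≤ C 2^{−|k₁−k₂|/2}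
  (‖u‖_{L⁴} + ‖u‖_{L^∞L²} + I(u,N)^{1/2}) (‖v‖_{L⁴} + ‖v‖_{L^∞L²} + I(v,N')^{1/2})`. -/
theorem core_bilinear_estimate :
    ∃ C : NNReal, 0 < C ∧
      ∀ k₁ k₂ : ℤ, ∀ u v : ℝ × ℝ × ℝ → ℂ,
        ContDiff ℝ (⊤ : ℕ∞) u → ContDiff ℝ (⊤ : ℕ∞) v →
        (∀ t : ℝ, ∃ g : SchwartzMap (ℝ × ℝ) ℂ, ∀ x : ℝ × ℝ, g x = u (t, x.1, x.2)) →
        (∀ t : ℝ, ∃ g : SchwartzMap (ℝ × ℝ) ℂ, ∀ x : ℝ × ℝ, g x = v (t, x.1, x.2)) →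
        (∀ (t : ℝ) (ξ : ℝ × ℝ), spatialFourier (fun x => u (t, x.1, x.2)) ξ ≠ 0 →
          (2 : ℝ) ^ (k₁ - 1) ≤ elen ξ ∧ elen ξ ≤ (2 : ℝ) ^ (k₁ + 1)) →
        (∀ (t : ℝ) (ξ : ℝ × ℝ), spatialFourier (fun x => v (t, x.1, x.2)) ξ ≠ 0 →
          (2 : ℝ) ^ (k₂ - 1) ≤ elen ξ ∧ elen ξ ≤ (2 : ℝ) ^ (k₂ + 1)) →
        ∀ y : ℝ × ℝ,
          L2norm (fun p => u (p.1, p.2.1 - y.1, p.2.2 - y.2) * v p) ≤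
            (C : ℝ≥0∞) * (2 : ℝ≥0∞) ^ (-|(k₁ : ℝ) - (k₂ : ℝ)| / 2) *
              (L4norm u + LinfL2 u + interact u (hypSchrod u) ^ (1 / 2 : ℝ)) *
              (L4norm v + LinfL2 v + interact v (hypSchrod v) ^ (1 / 2 : ℝ)) := by
  have hC : separatedConst + 2 ≠ ∞ := by
    have := separatedConst_ne_top
    finiteness
  refine ⟨(separatedConst + 2).toNNReal, ENNReal.toNNReal_pos (by simp) hC, ?_⟩
  intro k₁ k₂ u v hu hv su sv fu fv y
  have Hu : FreqLocalized k₁ u := ⟨hu, su, fu⟩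
  have Hv : FreqLocalized k₂ v := ⟨hv, sv, fv⟩
  have Hy := Hu.spaceTranslate y
  have hy : (fun p => u (p.1, p.2.1 - y.1, p.2.2 - y.2) * v p) =
      fun p => spaceTranslate y u p * v p := by
    ext p
    rw [show spaceTranslate y u p = u (p.1, p.2 - y) from spaceTranslate_apply y u p.1 p.2]
    rfl
  rw [ENNReal.coe_toNNReal hC, hy]
  change _ ≤ _ * solutionNorm u * solutionNorm v
  rw [← solutionNorm_spaceTranslate y u]
  by_cases h0 : solutionNorm (spaceTranslate y u) = 0 ∨ solutionNorm v = 0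
  · rw [L2norm_mul_eq_zero Hy.bandLimited.measurable Hv.bandLimited.measurable h0]
    exact zero_le
  push Not at h0
  by_cases hX : solutionNorm (spaceTranslate y u) ≠ ∞ ∧ solutionNorm v ≠ ∞
  · exact Hy.L2norm_mul_le_of_ne_top Hv hX.1 hX.2
  · refine le_top.trans_eq (Eq.symm ?_)
    have hd : (separatedConst + 2) * (2 : ℝ≥0∞) ^ (-|(k₁ : ℝ) - (k₂ : ℝ)| / 2) ≠ 0 :=
      mul_ne_zero (by simp) (ENNReal.rpow_pos two_pos (by simp)).ne'
    rw [not_and_or, not_not, not_not] at hX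
    rcases hX with h | h
    · rw [h, ENNReal.mul_top hd, ENNReal.top_mul h0.2]
    · rw [h, ENNReal.mul_top (mul_ne_zero hd h0.1)]

end
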